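/- arXiv:2207.06736 — 4 statements merged into one kernel-verified Lean document; each statement's English description precedes it below -/
import Mathlib

section
/- Let ℓ ∈ ℕ, ℓ ≥ 1, and let 0 < λ ≤ 2ℓ, with the Zygmund norm defined using the Ditzian–Totik modulus of order r = 2ℓ. Then there exists a constant C, independent of m and f, such that for every f ∈ Z_λ and every m ≥ 1, ‖f − B_{m,ℓ}(f)‖ ≤ C · m^{−λ/2} · ‖f‖_{Z_λ}. -/
open Set MeasureTheory

/-- Bernstein basis polynomial `p_{m,k}(x) = C(m,k) x^k (1-x)^(m-k)`. -/
noncomputable def bern (m k : ℕ) (x : ℝ) : ℝ :=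
  (m.choose k : ℝ) * x ^ k * (1 - x) ^ (m - k)

/-- The Bernstein operator `B_m`. -/
noncomputable def Bop (m : ℕ) (f : ℝ → ℝ) : ℝ → ℝ :=
  fun x => ∑ k ∈ Finset.range (m + 1), bern m k x * f ((k : ℝ) / (m : ℝ))

/-- The generalized Bernstein operator `B_{m,ℓ} = I - (I - B_m)^ℓ`. -/
noncomputable def GBop (m l : ℕ) (f : ℝ → ℝ) : ℝ → ℝ :=
  fun x => f x - ((fun g => g - Bop m g)^[l] f) x

/-- Fundamental generalized Bernstein polynomials
`p^{(ℓ)}_{m,j} = ∑_{i=1}^ℓ C(ℓ,i) (-1)^{i-1} B_m^{i-1}(p_{m,j})`. -/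
noncomputable def gbBasis (m l j : ℕ) : ℝ → ℝ :=
  fun x => ∑ i ∈ Finset.Icc 1 l,
    (l.choose i : ℝ) * (-1 : ℝ) ^ (i - 1) * ((Bop m)^[i - 1] (bern m j) x)

/-- Sup norm on `[0,1]`. -/
noncomputable def supNorm (f : ℝ → ℝ) : ℝ := ⨆ x : Set.Icc (0 : ℝ) 1, |f (x : ℝ)|

/-- `φ(x) = √(x(1-x))`. -/
noncomputable def phiDT (x : ℝ) : ℝ := Real.sqrt (x * (1 - x))

/-- Symmetric difference `Δ^r_{hφ} f(x)`. -/
noncomputable def dtDiff (r : ℕ) (h : ℝ) (f : ℝ → ℝ) (x : ℝ) : ℝ :=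
  ∑ k ∈ Finset.range (r + 1),
    (-1 : ℝ) ^ k * (r.choose k : ℝ) * f (x + ((r : ℝ) - 2 * k) * (h / 2) * phiDT x)

/-- `x ∈ [0,1]` and all the nodes of `Δ^r_{hφ} f(x)` lie in `[0,1]`. -/
def dtAdmissible (r : ℕ) (h : ℝ) (x : ℝ) : Prop :=
  x ∈ Set.Icc (0 : ℝ) 1 ∧
    ∀ k ≤ r, x + ((r : ℝ) - 2 * k) * (h / 2) * phiDT x ∈ Set.Icc (0 : ℝ) 1

/-- Ditzian–Totik modulus of smoothness `ω^r_φ(f,t)`. -/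
noncomputable def omegaDT (r : ℕ) (f : ℝ → ℝ) (t : ℝ) : ℝ :=
  sSup {y | ∃ h x, 0 < h ∧ h ≤ t ∧ dtAdmissible r h x ∧ y = |dtDiff r h f x|}

/-- The set of quotients `ω^r_φ(f,t)/t^λ`, `t > 0`. -/
def zygSet (lam : ℝ) (r : ℕ) (f : ℝ → ℝ) : Set ℝ :=
  {y | ∃ t : ℝ, 0 < t ∧ y = omegaDT r f t / t ^ lam}

/-- Membership in the Hölder–Zygmund space `Z_λ` (modulus of order `r`). -/
def memZ (lam : ℝ) (r : ℕ) (f : ℝ → ℝ) : Prop :=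
  ContinuousOn f (Set.Icc 0 1) ∧ BddAbove (zygSet lam r f)

/-- The Zygmund norm `‖f‖_{Z_λ} = ‖f‖ + sup_{t>0} ω^r_φ(f,t)/t^λ`. -/
noncomputable def Znorm (lam : ℝ) (r : ℕ) (f : ℝ → ℝ) : ℝ :=
  supNorm f + sSup (zygSet lam r f)

/-- Volterra integral operator `(Vf)(s) = ∫_0^s k(t,s) f(t) (s-t)^α t^β dt`. -/
noncomputable def Vop (alp bet : ℝ) (k : ℝ → ℝ → ℝ) (f : ℝ → ℝ) (s : ℝ) : ℝ :=
  ∫ t in (0 : ℝ)..s, k t s * f t * (s - t) ^ alp * t ^ bet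

/-- Quadrature coefficients `Q^{(ℓ)}_j(s) = ∫_0^s p^{(ℓ)}_{m,j}(t)(s-t)^α t^β dt`. -/
noncomputable def Qcoef (alp bet : ℝ) (m l j : ℕ) (s : ℝ) : ℝ :=
  ∫ t in (0 : ℝ)..s, gbBasis m l j t * (s - t) ^ alp * t ^ bet

/-- Discrete Volterra operator `(V_m^{(ℓ)}f)(s) = ∑_j Q^{(ℓ)}_j(s) k(j/m,s) f(j/m)`. -/
noncomputable def Vmop (alp bet : ℝ) (k : ℝ → ℝ → ℝ) (m l : ℕ) (f : ℝ → ℝ) (s : ℝ) : ℝ :=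
  ∑ j ∈ Finset.range (m + 1),
    Qcoef alp bet m l j s * k ((j : ℝ) / (m : ℝ)) s * f ((j : ℝ) / (m : ℝ))

namespace GenBernstein

open Polynomial

/-- The Bernstein operator acting on polynomials. -/
noncomputable def bernPoly (m : ℕ) : ℝ[X] →ₗ[ℝ] ℝ[X] where
  toFun p := ∑ k ∈ Finset.range (m + 1),
    C (p.eval ((k : ℝ) / (m : ℝ))) * bernsteinPolynomial ℝ m k
  map_add' p q := by simp [add_mul, Finset.sum_add_distrib]
  map_smul' a p := by simp [Finset.smul_sum, smul_eq_C_mul, mul_assoc]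

lemma bernPoly_apply (m : ℕ) (p : ℝ[X]) :
    bernPoly m p = ∑ k ∈ Finset.range (m + 1),
      C (p.eval ((k : ℝ) / (m : ℝ))) * bernsteinPolynomial ℝ m k := rfl

lemma eval_bernPoly (m : ℕ) (p : ℝ[X]) (x : ℝ) :
    (bernPoly m p).eval x = Bop m (fun y => p.eval y) x := by
  simp only [bernPoly_apply, Bop, bern, bernsteinPolynomial, eval_finsetSum]
  refine Finset.sum_congr rfl fun k _ => ?_
  simp; ring

lemma bernPoly_C (m : ℕ) (c : ℝ) : bernPoly m (C c) = C c := by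
  simp only [bernPoly_apply, eval_C, ← Finset.mul_sum, bernsteinPolynomial.sum, mul_one]

lemma bernPoly_C_mul (m : ℕ) (c : ℝ) (p : ℝ[X]) :
    bernPoly m (C c * p) = C c * bernPoly m p := by
  rw [← smul_eq_C_mul, map_smul, smul_eq_C_mul]

lemma X_mul_one_sub_X_mul_derivative_bernsteinPolynomial {m k : ℕ} (hk : k ≤ m) :
    X * (1 - X) * derivative (bernsteinPolynomial ℝ m k)
      = (C (k : ℝ) - C (m : ℝ) * X) * bernsteinPolynomial ℝ m k := by
  obtain ⟨n, rfl⟩ := Nat.exists_eq_add_of_le hk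
  have h1 : ∀ (i : ℕ) (q : ℝ[X]), q * (C (i : ℝ) * q ^ (i - 1)) = C (i : ℝ) * q ^ i := by
    intro i q
    rcases i with _ | i
    · simp
    · simp only [Nat.add_sub_cancel]; ring
  have hX := h1 k X
  have hY := h1 n (1 - X)
  simp only [bernsteinPolynomial, Nat.add_sub_cancel_left, derivative_mul, derivative_natCast, derivative_pow, derivative_sub, derivative_one, derivative_X, zero_mul,
    zero_add, zero_sub]
  have hc : C ((k + n : ℕ) : ℝ) = C (k : ℝ) + C (n : ℝ) := by simp
  rw [hc]
  linear_combination ((k + n).choose k : ℝ[X]) * (1 - X) ^ n * (1 - X) * hX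
    - ((k + n).choose k : ℝ[X]) * X ^ k * X * hY

/-- `B_m (y f) = y B_m f + y (1 - y) / m * (B_m f)'`. -/
lemma bernPoly_X_mul (m : ℕ) (p : ℝ[X]) :
    bernPoly (m + 1) (X * p) = X * bernPoly (m + 1) p
      + C ((m + 1 : ℝ)⁻¹) * (X * (1 - X)) * derivative (bernPoly (m + 1) p) := by
  simp only [bernPoly_apply, derivative_sum, Finset.mul_sum, ← Finset.sum_add_distrib]
  refine Finset.sum_congr rfl fun k hk => ?_
  have h := X_mul_one_sub_X_mul_derivative_bernsteinPolynomial
    (Nat.lt_succ_iff.mp (Finset.mem_range.mp hk))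
  have hm : C ((m + 1 : ℝ)⁻¹) * C (((m + 1 : ℕ) : ℝ)) = 1 := by
    rw [← C_mul, Nat.cast_succ, inv_mul_cancel₀ (by positivity), C_1]
  have hd : C ((k : ℝ) / ((m + 1 : ℕ) : ℝ)) = C ((m + 1 : ℝ)⁻¹) * C (k : ℝ) := by
    rw [← C_mul, Nat.cast_succ, div_eq_inv_mul]
  simp only [eval_mul, eval_X, C_mul, derivative_C_mul, hd]
  set E := C (eval ((k : ℝ) / ((m + 1 : ℕ) : ℝ)) p)
  linear_combination (-C ((m + 1 : ℝ)⁻¹) * E) * h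
    + (X * E * bernsteinPolynomial ℝ (m + 1) k) * hm

/-- A filtration of the polynomials in `y` depending on `m` and `x`, generated by `y - x`,
`y (1 - y)` and `1 / (m + 1)` with weights `(ω, 1)`, `(0, 1)` and `(2, 1)`. -/
inductive Filt (ω : ℕ) : ℕ → ℕ → (ℕ → ℝ → ℝ[X]) → Prop
  | const (c : ℝ) : Filt ω 0 0 (fun _ _ => C c)
  | add {s n : ℕ} {F G : ℕ → ℝ → ℝ[X]} : Filt ω s n F → Filt ω s n G →
      Filt ω s n (fun m x => F m x + G m x)
  | X_mul {s n : ℕ} {F : ℕ → ℝ → ℝ[X]} : Filt ω s n F → Filt ω s n (fun m x => X * F m x)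
  | sub_mul {s n : ℕ} {F : ℕ → ℝ → ℝ[X]} : Filt ω s n F →
      Filt ω (s + ω) (n + 1) (fun m x => (X - C x) * F m x)
  | phi_mul {s n : ℕ} {F : ℕ → ℝ → ℝ[X]} : Filt ω s n F →
      Filt ω s (n + 1) (fun m x => X * (1 - X) * F m x)
  | inv_mul {s n : ℕ} {F : ℕ → ℝ → ℝ[X]} : Filt ω s n F →
      Filt ω (s + 2) (n + 1) (fun m x => C ((m + 1 : ℝ)⁻¹) * F m x)
  | mono {s n s' n' : ℕ} {F : ℕ → ℝ → ℝ[X]} : s' ≤ s → n' ≤ n → Filt ω s n F → Filt ω s' n' F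

namespace Filt

variable {ω s n : ℕ} {F G : ℕ → ℝ → ℝ[X]}

lemma zero : Filt ω s n (fun _ _ => 0) := by
  have h : ∀ k, Filt ω (2 * k) k (fun _ _ => 0) := by
    intro k
    induction k with
    | zero => simpa using Filt.const (ω := ω) 0
    | succ k ih => simpa [Nat.mul_succ] using ih.inv_mul
  exact mono (by omega) (by omega) (h (s + n))

lemma neg (h : Filt ω s n F) : Filt ω s n (fun m x => -F m x) := by
  induction h with
  | const c => simpa using Filt.const (ω := ω) (-c)
  | add _ _ h1 h2 => simpa [add_comm] using h1.add h2
  | X_mul _ h => simpa using h.X_mul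
  | sub_mul _ h => simpa using h.sub_mul
  | phi_mul _ h => simpa using h.phi_mul
  | inv_mul _ h => simpa using h.inv_mul
  | mono h1 h2 _ h => exact h.mono h1 h2

lemma kappa_mul (h : Filt ω s n F) :
    Filt ω (s + 2) (n + 2) (fun m x => C ((m + 1 : ℝ)⁻¹) * (X * (1 - X)) * F m x) := by
  simpa only [mul_assoc] using h.phi_mul.inv_mul

lemma one_sub_two_X_mul (h : Filt ω s n F) : Filt ω s n (fun m x => (1 - 2 * X) * F m x) := by
  have := h.add ((h.X_mul.add h.X_mul).neg)
  convert this using 3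
  ring

lemma deriv (h : Filt ω s n F) : Filt ω (s - ω) (n - 1) (fun m x => derivative (F m x)) := by
  induction h with
  | const c => simpa using zero
  | add _ _ h1 h2 => simpa using h1.add h2
  | X_mul h0 h =>
    simpa [derivative_mul] using (h0.mono (by omega) (by omega)).add h.X_mul
  | sub_mul h0 h =>
    simpa [derivative_mul] using
      (h0.mono (by omega) (by omega)).add (h.sub_mul.mono (by omega) (by omega))
  | @phi_mul s n F h0 h =>
    have := (h0.one_sub_two_X_mul.mono (s' := s - ω) (n' := n + 1 - 1) (by omega) (by omega)).add
      (h.phi_mul.mono (by omega) (by omega))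
    convert this using 3
    simp only [derivative_mul, derivative_X, derivative_sub, derivative_one]
    ring
  | inv_mul h0 h =>
    simpa [derivative_mul] using h.inv_mul.mono (by omega) (by omega)
  | mono h1 h2 _ h => exact h.mono (by omega) (by omega)

lemma of_eq_add_kappa_mul {H : ℕ → ℝ → ℝ[X]} (hω : ω ≤ 1) (hF : Filt ω s n F)
    (hG : Filt ω (s - 2 * ω) (n - 2) G)
    (h : ∀ m x, H m x = F m x + C ((m + 1 : ℝ)⁻¹) * (X * (1 - X)) * G m x) :
    Filt ω s n H := by
  have : H = fun m x => F m x + C ((m + 1 : ℝ)⁻¹) * (X * (1 - X)) * G m x := by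
    funext m x; exact h m x
  rw [this]
  exact hF.add (hG.kappa_mul.mono (by omega) (by omega))

lemma exists_bernPoly_eq (hω : ω ≤ 1) (h : Filt ω s n F) :
    ∃ G, Filt ω (s - 2 * ω) (n - 2) G ∧ ∀ m x, bernPoly (m + 1) (F m x)
      = F m x + C ((m + 1 : ℝ)⁻¹) * (X * (1 - X)) * G m x := by
  induction h with
  | const c => exact ⟨fun _ _ => 0, zero, fun m x => by simp [bernPoly_C]⟩
  | add _ _ h1 h2 =>
    obtain ⟨G1, hG1, e1⟩ := h1
    obtain ⟨G2, hG2, e2⟩ := h2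
    exact ⟨_, hG1.add hG2, fun m x => by rw [map_add, e1, e2]; ring⟩
  | X_mul h0 h =>
    obtain ⟨G, hG, e⟩ := h
    have hH := of_eq_add_kappa_mul hω h0 hG e
    refine ⟨_, hG.X_mul.add (hH.deriv.mono (by omega) (by omega)), fun m x => ?_⟩
    rw [bernPoly_X_mul]
    linear_combination X * e m x
  | @sub_mul s n F h0 h =>
    obtain ⟨G, hG, e⟩ := h
    have hH := of_eq_add_kappa_mul hω h0 hG e
    refine ⟨_, (hG.sub_mul.mono (by omega) (by omega)).add (hH.deriv.mono (by omega) (by omega)),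
      fun m x => ?_⟩
    beta_reduce
    rw [_root_.sub_mul, map_sub, bernPoly_X_mul, bernPoly_C_mul]
    linear_combination (X - C x) * e m x
  | @phi_mul s n F h0 h =>
    obtain ⟨G, hG, e⟩ := h
    have hH := of_eq_add_kappa_mul hω h0 hG e
    refine ⟨_, ((hG.phi_mul.mono (by omega) (by omega)).add
      (hH.deriv.one_sub_two_X_mul.mono (by omega) (by omega))).add
      ((hH.neg.mono (by omega) (by omega)).add
        (hH.deriv.kappa_mul.deriv.neg.mono (by omega) (by omega))), fun m x => ?_⟩
    have e2 : X * (1 - X) * F m x = X * F m x - X * (X * F m x) := by ring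
    beta_reduce
    rw [e2, map_sub, bernPoly_X_mul, bernPoly_X_mul, bernPoly_X_mul]
    simp only [derivative_add, derivative_mul, derivative_X, derivative_C, derivative_sub,
      derivative_one]
    linear_combination (X * (1 - X)) * e m x
  | @inv_mul s n F h0 h =>
    obtain ⟨G, hG, e⟩ := h
    refine ⟨_, hG.inv_mul.mono (by omega) (by omega), fun m x => ?_⟩
    beta_reduce
    rw [bernPoly_C_mul, e]
    ring
  | mono h1 h2 _ h =>
    obtain ⟨G, hG, e⟩ := h
    exact ⟨G, hG.mono (by omega) (by omega), e⟩

lemma one_add_bernPoly (hω : ω ≤ 1) (h : Filt ω s n F) :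
    Filt ω s n (fun m x => (1 + bernPoly (m + 1) : Module.End ℝ ℝ[X]) (F m x)) := by
  obtain ⟨G, hG, e⟩ := h.exists_bernPoly_eq hω
  simpa using h.add (of_eq_add_kappa_mul hω h hG e)

lemma exists_one_sub_bernPoly_eq (h : Filt 0 s n F) :
    ∃ G, Filt 0 s (n - 2) G ∧ ∀ m x, (1 - bernPoly (m + 1) : Module.End ℝ ℝ[X]) (F m x)
      = C ((m + 1 : ℝ)⁻¹) * (X * (1 - X)) * G m x := by
  obtain ⟨G, hG, e⟩ := h.exists_bernPoly_eq (by omega)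
  exact ⟨_, hG.neg, fun m x => by simp [e]⟩

lemma one_sub_bernPoly (h : Filt 0 s n F) :
    Filt 0 (s + 2) n (fun m x => (1 - bernPoly (m + 1) : Module.End ℝ ℝ[X]) (F m x)) := by
  obtain ⟨G, hG, e⟩ := h.exists_one_sub_bernPoly_eq
  simp only [e]
  exact hG.kappa_mul.mono le_rfl (by omega)

lemma sub_pow (ω k : ℕ) : Filt ω (k * ω) k (fun _ x => (X - C x) ^ k) := by
  induction k with
  | zero => simpa using Filt.const (ω := ω) 1
  | succ k ih => simpa only [pow_succ', Nat.succ_mul] using ih.sub_mul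

end Filt

/-- The scale `m^{-1/2}` for the index `m + 1`. -/
noncomputable def tt (m : ℕ) : ℝ := Real.sqrt ((m + 1 : ℝ)⁻¹)

/-- The scale `max (φ(x), m^{-1/2})` for the index `m + 1`. -/
noncomputable def dd (m : ℕ) (x : ℝ) : ℝ := max (phiDT x) (tt m)

lemma tt_pos (m : ℕ) : 0 < tt m := Real.sqrt_pos.mpr (by positivity)

lemma tt_sq (m : ℕ) : tt m ^ 2 = (m + 1 : ℝ)⁻¹ := Real.sq_sqrt (by positivity)

lemma tt_le_one (m : ℕ) : tt m ≤ 1 :=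
  Real.sqrt_le_one.mpr (inv_le_one_of_one_le₀ (by linarith [Nat.cast_nonneg (α := ℝ) m]))

lemma tt_le_dd (m : ℕ) (x : ℝ) : tt m ≤ dd m x := le_max_right _ _

lemma dd_pos (m : ℕ) (x : ℝ) : 0 < dd m x := (tt_pos m).trans_le (tt_le_dd m x)

lemma dd_le_one (m : ℕ) (x : ℝ) : dd m x ≤ 1 :=
  max_le (Real.sqrt_le_one.mpr (by nlinarith [sq_nonneg (x - 1 / 2)])) (tt_le_one m)

lemma phiDT_sq {x : ℝ} (hx : x ∈ Icc (0 : ℝ) 1) : phiDT x ^ 2 = x * (1 - x) :=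
  Real.sq_sqrt (mul_nonneg hx.1 (by linarith [hx.2]))

lemma phi_le_dd_sq {x : ℝ} (hx : x ∈ Icc (0 : ℝ) 1) (m : ℕ) : x * (1 - x) ≤ dd m x ^ 2 := by
  rw [← phiDT_sq hx]
  exact pow_le_pow_left₀ (Real.sqrt_nonneg _) (le_max_left _ _) 2

lemma Filt.eval_le {ω s n : ℕ} {F : ℕ → ℝ → ℝ[X]} (h : Filt ω s n F) :
    ∃ K, 0 ≤ K ∧ ∀ m, ∀ x ∈ Icc (0 : ℝ) 1,
      |(F m x).eval x| ≤ K * (tt m ^ s * dd m x ^ (2 * n - s)) := by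
  induction h with
  | const c => exact ⟨|c|, abs_nonneg c, fun m x _ => by simp⟩
  | add _ _ h1 h2 =>
    obtain ⟨K1, hK1, e1⟩ := h1
    obtain ⟨K2, hK2, e2⟩ := h2
    refine ⟨K1 + K2, by positivity, fun m x hx => ?_⟩
    rw [eval_add, add_mul]
    exact (abs_add_le _ _).trans (add_le_add (e1 m x hx) (e2 m x hx))
  | X_mul _ h =>
    obtain ⟨K, hK, e⟩ := h
    refine ⟨K, hK, fun m x hx => ?_⟩
    rw [eval_mul, eval_X, abs_mul, abs_of_nonneg hx.1]
    exact (mul_le_of_le_one_left (abs_nonneg _) hx.2).trans (e m x hx)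
  | sub_mul _ _ =>
    refine ⟨0, le_rfl, fun m x _ => by simp⟩
  | @phi_mul s n F _ h =>
    obtain ⟨K, hK, e⟩ := h
    refine ⟨K, hK, fun m x hx => ?_⟩
    have h0 : 0 ≤ x * (1 - x) := mul_nonneg hx.1 (by linarith [hx.2])
    have hd := (dd_pos m x).le
    have ht := (tt_pos m).le
    calc |(X * (1 - X) * F m x).eval x| = x * (1 - x) * |(F m x).eval x| := by
          simp only [eval_mul, eval_X, eval_sub, eval_one]
          rw [abs_mul, abs_of_nonneg h0]
      _ ≤ dd m x ^ 2 * (K * (tt m ^ s * dd m x ^ (2 * n - s))) :=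
          mul_le_mul (phi_le_dd_sq hx m) (e m x hx) (abs_nonneg _) (by positivity)
      _ = K * (tt m ^ s * dd m x ^ (2 * n - s + 2)) := by ring
      _ ≤ _ := by
          gcongr _ * (_ * ?_)
          exact pow_le_pow_of_le_one hd (dd_le_one m x) (by omega)
  | @inv_mul s n F _ h =>
    obtain ⟨K, hK, e⟩ := h
    refine ⟨K, hK, fun m x hx => ?_⟩
    have h0 : 0 ≤ (m + 1 : ℝ)⁻¹ := by positivity
    rw [eval_mul, eval_C, abs_mul, abs_of_nonneg h0, ← tt_sq,
      show 2 * (n + 1) - (s + 2) = 2 * n - s by omega]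
    calc tt m ^ 2 * |(F m x).eval x| ≤ tt m ^ 2 * (K * (tt m ^ s * dd m x ^ (2 * n - s))) := by
          gcongr; exact e m x hx
      _ = _ := by ring
  | @mono s n s' n' F h1 h2 _ h =>
    obtain ⟨K, hK, e⟩ := h
    refine ⟨K, hK, fun m x hx => (e m x hx).trans ?_⟩
    have hd := (dd_pos m x).le
    have ht := (tt_pos m).le
    gcongr K * ?_
    calc tt m ^ s * dd m x ^ (2 * n - s)
        = tt m ^ s' * (tt m ^ (s - s') * dd m x ^ (2 * n - s)) := by
          rw [← mul_assoc, ← pow_add, Nat.add_sub_cancel' h1]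
      _ ≤ tt m ^ s' * (dd m x ^ (s - s') * dd m x ^ (2 * n - s)) := by
          gcongr; exact tt_le_dd m x
      _ ≤ _ := by
          rw [← pow_add]
          gcongr _ * ?_
          exact pow_le_pow_of_le_one hd (dd_le_one m x) (by omega)

/-- Size of `(I - B_m)^l ((· - x)^j)` at `x`. -/
lemma exists_one_sub_bernPoly_pow_le (l j : ℕ) :
    ∃ K, 0 ≤ K ∧ ∀ m, ∀ x ∈ Icc (0 : ℝ) 1,
      |((((1 - bernPoly (m + 1) : Module.End ℝ ℝ[X]) ^ (l + 1))
        ((X - C x) ^ j)).eval x)|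
        ≤ K * (tt m ^ (2 * (l + 1)) * dd m x ^ (2 * max 1 (j - (l + 1)))) := by
  have h : ∀ i, Filt 0 (2 * i) j (fun m x =>
      ((1 - bernPoly (m + 1) : Module.End ℝ ℝ[X]) ^ i) ((X - C x) ^ j)) := by
    intro i
    induction i with
    | zero => simpa using Filt.sub_pow 0 j
    | succ i ih => simpa only [pow_succ', Nat.mul_succ, Module.End.mul_apply] using ih.one_sub_bernPoly
  obtain ⟨G, hG, e⟩ := (h l).exists_one_sub_bernPoly_eq
  obtain ⟨K, hK, b⟩ := hG.eval_le
  refine ⟨K, hK, fun m x hx => ?_⟩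
  have h0 : 0 ≤ x * (1 - x) := mul_nonneg hx.1 (by linarith [hx.2])
  have hd := (dd_pos m x).le
  have ht := (tt_pos m).le
  rw [pow_succ', Module.End.mul_apply, e]
  calc |(C ((m + 1 : ℝ)⁻¹) * (X * (1 - X)) * G m x).eval x|
      = tt m ^ 2 * (x * (1 - x)) * |(G m x).eval x| := by
        simp only [eval_mul, eval_X, eval_sub, eval_one, eval_C]
        rw [abs_mul, abs_of_nonneg (mul_nonneg (by positivity) h0), tt_sq]
    _ ≤ tt m ^ 2 * dd m x ^ 2 * (K * (tt m ^ (2 * l) * dd m x ^ (2 * (j - 2) - 2 * l))) := by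
        gcongr
        · exact phi_le_dd_sq hx m
        · exact b m x hx
    _ = K * (tt m ^ (2 * (l + 1)) * dd m x ^ (2 + (2 * (j - 2) - 2 * l))) := by ring
    _ ≤ _ := by
        gcongr _ * (_ * ?_)
        exact pow_le_pow_of_le_one hd (dd_le_one m x) (by omega)

/-- Size of `(I + B_m)^l ((· - x)^k)` at `x`. -/
lemma exists_one_add_bernPoly_pow_le (l k : ℕ) :
    ∃ K, 0 ≤ K ∧ ∀ m, ∀ x ∈ Icc (0 : ℝ) 1,
      |((((1 + bernPoly (m + 1) : Module.End ℝ ℝ[X]) ^ l)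
        ((X - C x) ^ k)).eval x)| ≤ K * (tt m * dd m x) ^ k := by
  have h : ∀ i, Filt 1 k k (fun m x =>
      ((1 + bernPoly (m + 1) : Module.End ℝ ℝ[X]) ^ i) ((X - C x) ^ k)) := by
    intro i
    induction i with
    | zero => simpa using Filt.sub_pow 1 k
    | succ i ih => simpa only [pow_succ', Module.End.mul_apply] using ih.one_add_bernPoly le_rfl
  obtain ⟨K, hK, b⟩ := (h l).eval_le
  refine ⟨K, hK, fun m x hx => (b m x hx).trans_eq ?_⟩
  rw [mul_pow, show 2 * k - k = k by omega]


/-- The difference `∑ (-1)^k C(r,k) f (y + k s)`. -/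
noncomputable def fdiff (r : ℕ) (s : ℝ) (f : ℝ → ℝ) (y : ℝ) : ℝ :=
  ∑ k ∈ Finset.range (r + 1), (-1 : ℝ) ^ k * (r.choose k : ℝ) * f (y + k * s)

lemma fdiff_zero (n : ℕ) (f : ℝ → ℝ) (y : ℝ) : fdiff (n + 1) 0 f y = 0 := by
  have h : ∑ k ∈ Finset.range (n + 1 + 1), (-1 : ℝ) ^ k * ((n + 1).choose k : ℝ) = 0 := by
    exact_mod_cast Int.alternating_sum_range_choose_of_ne (Nat.succ_ne_zero n)
  simp only [fdiff, mul_zero, add_zero, ← Finset.sum_mul, h, zero_mul]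

lemma fdiff_neg (r : ℕ) (s : ℝ) (f : ℝ → ℝ) (y : ℝ) :
    fdiff r (-s) f (y + r * s) = (-1) ^ r * fdiff r s f y := by
  unfold fdiff
  rw [← Finset.sum_range_reflect, Finset.mul_sum]
  refine Finset.sum_congr rfl fun k hk => ?_
  have hk' : k ≤ r := Nat.lt_succ_iff.mp (Finset.mem_range.mp hk)
  obtain ⟨j, rfl⟩ := Nat.exists_eq_add_of_le hk'
  have e1 : k + j + 1 - 1 - k = j := by omega
  have e2 : (k + j).choose j = (k + j).choose k := by
    rw [Nat.choose_symm_add]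
  have e3 : (-1 : ℝ) ^ (k + j) * (-1) ^ k = (-1) ^ j := by
    rw [pow_add, mul_right_comm, ← mul_pow]; simp
  rw [e1, e2, ← e3]
  have e4 : y + ((k + j : ℕ) : ℝ) * s + (j : ℝ) * (-s) = y + k * s := by push_cast; ring
  rw [e4]; ring

lemma abs_fwdDiff_iter_eq (r : ℕ) (s : ℝ) (f : ℝ → ℝ) (y : ℝ) :
    |(fwdDiff s)^[r] f y| = |fdiff r s f y| := by
  have h : (fwdDiff s)^[r] f y = (-1) ^ r * fdiff r s f y := by
    rw [fwdDiff_iter_eq_sum_shift, fdiff, Finset.mul_sum]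
    refine Finset.sum_congr rfl fun k hk => ?_
    have hk' : k ≤ r := Nat.lt_succ_iff.mp (Finset.mem_range.mp hk)
    obtain ⟨j, rfl⟩ := Nat.exists_eq_add_of_le hk'
    have e3 : (-1 : ℝ) ^ (k + j) * (-1) ^ k = (-1) ^ j := by
      rw [pow_add, mul_right_comm, ← mul_pow]; simp
    rw [Nat.add_sub_cancel_left, ← mul_assoc, ← mul_assoc, e3]
    simp
  rw [h, abs_mul, abs_pow]
  simp

/-- The average of `f` over `[x, x + s]`. -/
noncomputable def av (s : ℝ) (f : ℝ → ℝ) (x : ℝ) : ℝ := ∫ u in (0 : ℝ)..1, f (x + s * u)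

lemma av_zero (f : ℝ → ℝ) : av 0 f = f := by
  funext x; simp [av]

lemma continuous_av {f : ℝ → ℝ} (hf : Continuous f) (s : ℝ) : Continuous (av s f) :=
  intervalIntegral.continuous_parametric_intervalIntegral_of_continuous' (by fun_prop) _ _

lemma continuous_av_iter {f : ℝ → ℝ} (hf : Continuous f) (s : ℝ) (n : ℕ) :
    Continuous ((av s)^[n] f) := by
  induction n with
  | zero => exact hf
  | succ n ih => rw [Function.iterate_succ_apply']; exact continuous_av ih s

lemma hasDerivAt_av {f : ℝ → ℝ} (hf : Continuous f) {s : ℝ} (hs : s ≠ 0) (x : ℝ) :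
    HasDerivAt (av s f) (s⁻¹ * fwdDiff s f x) x := by
  have h : av s f = fun x => s⁻¹ * ((∫ y in (0 : ℝ)..(x + s), f y) - ∫ y in (0 : ℝ)..x, f y) := by
    funext x
    have h1 := intervalIntegral.mul_integral_comp_add_mul (f := f) (a := 0) (b := 1) s x
    rw [intervalIntegral.integral_interval_sub_left (hf.intervalIntegrable _ _)
      (hf.intervalIntegrable _ _)]
    simp only [mul_zero, add_zero, mul_one] at h1
    rw [← h1, inv_mul_cancel_left₀ hs, av]
  have hd : ∀ z, HasDerivAt (fun z => ∫ y in (0 : ℝ)..z, f y) (f z) z := fun z =>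
    intervalIntegral.integral_hasDerivAt_right (hf.intervalIntegrable _ _)
      hf.aestronglyMeasurable.stronglyMeasurableAtFilter hf.continuousAt
  rw [h]
  exact (((hd (x + s)).comp_add_const x s).sub (hd x)).const_mul _

lemma hasDerivAt_fwdDiff_iter {g g' : ℝ → ℝ} (h : ∀ x, HasDerivAt g (g' x) x) (s : ℝ) (n : ℕ) :
    ∀ x, HasDerivAt ((fwdDiff s)^[n] g) ((fwdDiff s)^[n] g' x) x := by
  induction n with
  | zero => exact h
  | succ n ih =>
    intro x
    rw [Function.iterate_succ_apply', Function.iterate_succ_apply']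
    exact ((ih (x + s)).comp_add_const x s).sub (ih x)

lemma taylor_chain {r : ℕ} {c K : ℝ} (hc : c ≤ 1) (hK : 0 ≤ K) (G : ℕ → ℝ → ℝ)
    (hG : ∀ i < r, ∀ x, HasDerivAt (G i) (G (i + 1) x) x)
    (hb : ∀ x ∈ Icc 0 c, |G r x| ≤ K) :
    ∀ x ∈ Icc 0 c, |G 0 x - ∑ i ∈ Finset.range r, G i 0 / (i.factorial : ℝ) * x ^ i| ≤ K := by
  induction r generalizing G with
  | zero => simpa using hb
  | succ r ih =>
    have h1 := ih (fun i => G (i + 1)) (fun i hi x => hG (i + 1) (by omega) x) hb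
    intro x hx
    set T : ℝ → ℝ := fun x =>
      G 0 x - ∑ i ∈ Finset.range (r + 1), G i 0 / (i.factorial : ℝ) * x ^ i with hT
    have hd : ∀ y, HasDerivAt T
        (G 1 y - ∑ i ∈ Finset.range r, G (i + 1) 0 / (i.factorial : ℝ) * y ^ i) y := by
      intro y
      refine (hG 0 (by omega) y).sub ?_
      have := HasDerivAt.fun_sum (u := Finset.range (r + 1))
        (A := fun i y => G i 0 / (i.factorial : ℝ) * y ^ i) (x := y)
        (fun i _ => (hasDerivAt_pow i y).const_mul (G i 0 / (i.factorial : ℝ)))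
      convert this using 1
      rw [Finset.sum_range_succ']
      simp only [Nat.cast_zero, zero_mul, mul_zero, add_zero]
      refine Finset.sum_congr rfl fun i _ => ?_
      rw [Nat.factorial_succ]
      have := Nat.factorial_ne_zero i
      push_cast
      field_simp
    have hT0 : T 0 = 0 := by
      simp [hT, Finset.sum_range_succ']
    have := (convex_Icc 0 c).norm_image_sub_le_of_norm_hasDerivWithin_le (f := T) (C := K)
      (fun y _ => (hd y).hasDerivWithinAt) (fun y hy => h1 y hy)
      (left_mem_Icc.mpr (hx.1.trans hx.2)) hx
    rw [hT0, sub_zero, sub_zero, Real.norm_eq_abs, Real.norm_eq_abs, abs_of_nonneg hx.1] at this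
    exact this.trans (mul_le_of_le_one_right hK (hx.2.trans hc))

/-- Averaging in the step keeps the bound on the difference. -/
lemma abs_sum_av_le {f : ℝ → ℝ} (hf : Continuous f) {r : ℕ} {x η ε : ℝ} (hη : 0 ≤ η)
    (h : ∀ s ∈ Icc 0 (r * η), |fdiff r s f x| ≤ ε) (n : ℕ) :
    ∀ v, 0 ≤ v → v + n * η ≤ r * η →
      |∑ k ∈ Finset.range (r + 1), (-1 : ℝ) ^ k * (r.choose k : ℝ) *
        (av (k * η))^[n] f (x + k * v)| ≤ ε := by
  induction n with
  | zero =>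
    intro v hv hv'
    simpa [fdiff] using h v ⟨hv, by simpa using hv'⟩
  | succ n ih =>
    intro v hv hv'
    have e : ∑ k ∈ Finset.range (r + 1), (-1 : ℝ) ^ k * (r.choose k : ℝ) *
        (av (k * η))^[n + 1] f (x + k * v)
        = ∫ u in (0 : ℝ)..1, ∑ k ∈ Finset.range (r + 1), (-1 : ℝ) ^ k * (r.choose k : ℝ) *
          (av (k * η))^[n] f (x + k * (v + η * u)) := by
      rw [intervalIntegral.integral_finsetSum]
      · refine Finset.sum_congr rfl fun k _ => ?_
        rw [Function.iterate_succ_apply', av, ← intervalIntegral.integral_const_mul]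
        congr 1
        funext u
        ring_nf
      · intro k _
        have := continuous_av_iter hf (k * η) n
        exact Continuous.intervalIntegrable (by fun_prop) _ _
    rw [e]
    have := intervalIntegral.norm_integral_le_of_norm_le_const (a := 0) (b := 1) (C := ε)
      (f := fun u => ∑ k ∈ Finset.range (r + 1), (-1 : ℝ) ^ k * (r.choose k : ℝ) *
          (av (k * η))^[n] f (x + k * (v + η * u))) (fun u hu => ?_)
    · simpa using this
    · rw [uIoc_of_le zero_le_one] at hu
      refine ih _ (add_nonneg hv (mul_nonneg hη hu.1.le)) ?_
      push_cast at hv'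
      nlinarith [hu.2]

lemma whitney_left (n : ℕ) : ∃ K, 0 ≤ K ∧ ∀ (f : ℝ → ℝ) (ε : ℝ), Continuous f →
    (∀ s y : ℝ, 0 ≤ s → 0 ≤ y → y + ((n + 1 : ℕ) : ℝ) * s ≤ 1 → |fdiff (n + 1) s f y| ≤ ε) →
    ∃ P : ℝ[X], P.natDegree ≤ n ∧ ∀ x ∈ Icc (0 : ℝ) (2 / 3), |f x - P.eval x| ≤ K * ε := by
  set r := n + 1 with hr
  set η : ℝ := 1 / (3 * r ^ 2) with hη
  have hr0 : (0 : ℝ) < r := by rw [hr]; positivity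
  have hη0 : 0 < η := by positivity
  have hrη : (r : ℝ) * (r * η) = 1 / 3 := by rw [hη]; field_simp
  set A : ℝ := ∑ k ∈ Finset.range r, (r.choose (k + 1) : ℝ) * |(((k + 1 : ℕ) : ℝ) * η)⁻¹ ^ r|
  have hA : 0 ≤ A := by positivity
  refine ⟨1 + A, by positivity, fun f ε hf h => ?_⟩
  have hε : 0 ≤ ε := (abs_nonneg _).trans (h 0 0 le_rfl le_rfl (by simp))
  set G : ℕ → ℝ → ℝ := fun i x => ∑ k ∈ Finset.range r,
    (-((-1 : ℝ) ^ (k + 1) * (r.choose (k + 1) : ℝ))) * ((((k + 1 : ℕ) : ℝ) * η)⁻¹ ^ i *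
      (fwdDiff (((k + 1 : ℕ) : ℝ) * η))^[i] ((av (((k + 1 : ℕ) : ℝ) * η))^[r - i] f) x) with hG
  have hGd : ∀ i < r, ∀ x, HasDerivAt (G i) (G (i + 1) x) x := by
    intro i hi x
    refine HasDerivAt.fun_sum fun k _ => HasDerivAt.const_mul _ ?_
    have hs : ((k + 1 : ℕ) : ℝ) * η ≠ 0 := by positivity
    set s := ((k + 1 : ℕ) : ℝ) * η
    obtain ⟨j, hj⟩ : ∃ j, r - i = j + 1 := ⟨r - i - 1, by omega⟩
    rw [hj, show r - (i + 1) = j by omega, pow_succ, mul_assoc]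
    refine HasDerivAt.const_mul _ ?_
    have h1 := hasDerivAt_fwdDiff_iter
      (fun x => hasDerivAt_av (continuous_av_iter hf s j) hs x) s i x
    rw [Function.iterate_succ_apply']
    refine h1.congr_deriv ?_
    have h2 := fwdDiff_iter_const_smul (h := s) s⁻¹ (fwdDiff s ((av s)^[j] f)) i
    rw [Function.iterate_succ_apply]
    exact congrFun h2 x
  have hGr : ∀ x ∈ Icc (0 : ℝ) (2 / 3), |G r x| ≤ A * ε := by
    intro x hx
    rw [Finset.sum_mul]
    refine (Finset.abs_sum_le_sum_abs _ _).trans (Finset.sum_le_sum fun k hk => ?_)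
    rw [abs_mul, abs_mul, abs_fwdDiff_iter_eq, Nat.sub_self, Function.iterate_zero, id, mul_assoc]
    have hk : ((k + 1 : ℕ) : ℝ) ≤ r := by
      exact_mod_cast Finset.mem_range.mp hk
    have e1 : |-((-1 : ℝ) ^ (k + 1) * (r.choose (k + 1) : ℝ))| = (r.choose (k + 1) : ℝ) := by
      rw [abs_neg, abs_mul, abs_pow]; simp
    rw [e1]
    gcongr
    refine h _ _ (by positivity) hx.1 ?_
    have : (r : ℝ) * (((k + 1 : ℕ) : ℝ) * η) ≤ r * (r * η) := by gcongr
    linarith [hx.2]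
  have hT := taylor_chain (by norm_num) (mul_nonneg hA hε) G hGd hGr
  refine ⟨∑ i ∈ Finset.range r, C (G i 0 / (i.factorial : ℝ)) * X ^ i, ?_, fun x hx => ?_⟩
  · refine natDegree_sum_le_of_forall_le _ _ fun i hi => (natDegree_C_mul_X_pow_le _ _).trans ?_
    have := Finset.mem_range.mp hi
    omega
  · have h1 : |f x - G 0 x| ≤ ε := by
      have := abs_sum_av_le hf hη0.le (x := x) (ε := ε) (r := r) (fun s hs => h s x hs.1 hx.1 (by
        have : (r : ℝ) * s ≤ r * (r * η) := by gcongr; exact hs.2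
        linarith [hx.2])) r 0 le_rfl (by simp)
      rw [Finset.sum_range_succ'] at this
      convert this using 2
      simp only [hG, Function.iterate_zero, id, pow_zero, one_mul, Nat.sub_zero, mul_zero, add_zero,
        Nat.cast_zero, zero_mul, Nat.choose_zero_right, Nat.cast_one, neg_mul,
        Finset.sum_neg_distrib]
      rw [Function.iterate_fixed (av_zero f)]
      ring
    have h2 := hT x hx
    simp only [eval_finsetSum, eval_mul, eval_C, eval_pow, eval_X]
    calc _ ≤ |f x - G 0 x| + |G 0 x - ∑ i ∈ Finset.range r, G i 0 / (i.factorial : ℝ) * x ^ i| :=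
          abs_sub_le _ _ _
      _ ≤ ε + A * ε := add_le_add h1 h2
      _ = _ := by ring

/-- Polynomials of bounded degree: coefficients are controlled by the values on `[0,1]`. -/
lemma exists_abs_coeff_le (n : ℕ) : ∃ K, 0 ≤ K ∧ ∀ (p : ℝ[X]) (A : ℝ), p.natDegree ≤ n →
    (∀ v ∈ Icc (0 : ℝ) 1, |p.eval v| ≤ A) → ∀ j, |p.coeff j| ≤ K * A := by
  classical
  set s := Finset.range (n + 1)
  set v : ℕ → ℝ := fun i => (i : ℝ) / (n + 1)
  have hinj : Set.InjOn v s := by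
    intro a _ b _ hab
    have : (a : ℝ) = b := by
      simpa [v, div_left_inj' (show (n + 1 : ℝ) ≠ 0 by positivity)] using hab
    exact_mod_cast this
  set B : ℝ := ∑ j ∈ s, ∑ i ∈ s, |(Lagrange.basis s v i).coeff j|
  have hB : 0 ≤ B := by positivity
  refine ⟨B, hB, fun p A hp h j => ?_⟩
  have hA : 0 ≤ A := (abs_nonneg _).trans (h 0 (by simp))
  by_cases hj : j ∈ s
  · have hd : p.degree < s.card := by
      rw [Finset.card_range]
      exact (degree_le_of_natDegree_le hp).trans_lt (by exact_mod_cast Nat.lt_succ_self n)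
    have e := Lagrange.eq_interpolate hinj hd
    have e2 : p.coeff j = ∑ i ∈ s, p.eval (v i) * (Lagrange.basis s v i).coeff j := by
      conv_lhs => rw [e]
      simp [Lagrange.interpolate_apply, finsetSum_coeff]
    have h3 : ∑ i ∈ s, |(Lagrange.basis s v i).coeff j| ≤ B :=
      Finset.single_le_sum (f := fun j => ∑ i ∈ s, |(Lagrange.basis s v i).coeff j|)
        (fun _ _ => Finset.sum_nonneg fun _ _ => abs_nonneg _) hj
    calc |p.coeff j| ≤ ∑ i ∈ s, A * |(Lagrange.basis s v i).coeff j| := by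
          rw [e2]
          refine (Finset.abs_sum_le_sum_abs _ _).trans (Finset.sum_le_sum fun i hi => ?_)
          rw [abs_mul]
          gcongr
          refine h _ ⟨by positivity, (div_le_one (by positivity)).mpr ?_⟩
          exact_mod_cast (Finset.mem_range.mp hi).le
      _ ≤ B * A := by
          rw [← Finset.mul_sum, mul_comm]
          gcongr
  · rw [coeff_eq_zero_of_natDegree_lt, abs_zero]
    · positivity
    · have : ¬ j < n + 1 := fun h => hj (Finset.mem_range.mpr h)
      omega

lemma exists_abs_coeff_taylor_le (n : ℕ) : ∃ K, 0 ≤ K ∧ ∀ (p : ℝ[X]) (A x h : ℝ),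
    p.natDegree ≤ n → h ≠ 0 → (∀ v ∈ Icc (0 : ℝ) 1, |p.eval (x + h * v)| ≤ A) →
    ∀ j, |(taylor x p).coeff j| ≤ K * A / |h| ^ j := by
  obtain ⟨K, hK, b⟩ := exists_abs_coeff_le n
  refine ⟨K, hK, fun p A x h hp hh hb j => ?_⟩
  have h1 := b ((taylor x p).comp (C h * X)) A ?_ (fun v hv => ?_) j
  · rw [comp_C_mul_X_coeff, abs_mul, abs_pow] at h1
    rwa [le_div_iff₀ (by positivity)]
  · refine natDegree_comp_le.trans ?_
    rw [natDegree_taylor]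
    exact (Nat.mul_le_mul hp ((natDegree_C_mul_le _ _).trans natDegree_X_le)).trans_eq (mul_one n)
  · have := hb v hv
    simpa [taylor_apply, eval_comp, add_comm] using this

lemma eq_sum_taylor {n : ℕ} {p : ℝ[X]} (hp : p.natDegree ≤ n) (x : ℝ) :
    p = ∑ j ∈ Finset.range (n + 1), C ((taylor x p).coeff j) * (X - C x) ^ j := by
  conv_lhs => rw [← sum_taylor_eq p x]
  exact sum_over_range' _ (by simp) _ (by rw [natDegree_taylor]; omega)

/-- Growth of a polynomial of bounded degree away from a segment issued from `x`. -/
lemma exists_abs_eval_le (n : ℕ) : ∃ K, 0 ≤ K ∧ ∀ (p : ℝ[X]) (A x h R : ℝ),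
    p.natDegree ≤ n → h ≠ 0 → 1 ≤ R → (∀ v ∈ Icc (0 : ℝ) 1, |p.eval (x + h * v)| ≤ A) →
    ∀ y, |y - x| ≤ R * |h| → |p.eval y| ≤ K * A * R ^ n := by
  obtain ⟨K, hK, b⟩ := exists_abs_coeff_taylor_le n
  refine ⟨(n + 1) * K, by positivity, fun p A x h R hp hh hR hb y hy => ?_⟩
  have hA : 0 ≤ A := (abs_nonneg _).trans (hb 0 (by simp))
  have hh' : 0 < |h| := abs_pos.mpr hh
  rw [eq_sum_taylor hp x]
  simp only [eval_finsetSum, eval_mul, eval_C, eval_pow, eval_X, eval_sub]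
  calc _ ≤ ∑ j ∈ Finset.range (n + 1), K * A * R ^ n := by
        refine (Finset.abs_sum_le_sum_abs _ _).trans (Finset.sum_le_sum fun j hj => ?_)
        rw [abs_mul, abs_pow]
        calc _ ≤ K * A / |h| ^ j * (R * |h|) ^ j := by
              gcongr
              exact b p A x h hp hh hb j
          _ = K * A * R ^ j := by rw [mul_pow]; field_simp
          _ ≤ _ := by
              gcongr
              exact Nat.lt_succ_iff.mp (Finset.mem_range.mp hj)
    _ = _ := by simp; ring

lemma whitney_unit (n : ℕ) : ∃ K, 0 ≤ K ∧ ∀ (f : ℝ → ℝ) (ε : ℝ), Continuous f →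
    (∀ s y : ℝ, 0 ≤ s → 0 ≤ y → y + ((n + 1 : ℕ) : ℝ) * s ≤ 1 → |fdiff (n + 1) s f y| ≤ ε) →
    ∃ P : ℝ[X], P.natDegree ≤ n ∧ ∀ x ∈ Icc (0 : ℝ) 1, |f x - P.eval x| ≤ K * ε := by
  obtain ⟨K, hK, w⟩ := whitney_left n
  obtain ⟨L, hL, g⟩ := exists_abs_eval_le n
  refine ⟨K + L * (2 * K) * 2 ^ n, by positivity, fun f ε hf h => ?_⟩
  have hε : 0 ≤ ε := (abs_nonneg _).trans (h 0 0 le_rfl le_rfl (by simp))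
  obtain ⟨P, hP, hPf⟩ := w f ε hf h
  obtain ⟨Q, hQ, hQf⟩ := w (fun x => f (1 - x)) ε (by fun_prop) (fun s y hs hy hsy => by
    have e := fdiff_neg (n + 1) s f (1 - y - (n + 1 : ℕ) * s)
    have e' : fdiff (n + 1) s (fun x => f (1 - x)) y = fdiff (n + 1) (-s) f (1 - y) := by
      refine Finset.sum_congr rfl fun k _ => ?_
      ring_nf
    rw [sub_add_cancel] at e
    rw [e', e, abs_mul, abs_pow]
    simpa using h s (1 - y - (n + 1 : ℕ) * s) hs (by linarith) (by linarith))
  set Q' := Q.comp (1 - X)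
  have hQ' : Q'.natDegree ≤ n := by
    refine natDegree_comp_le.trans ?_
    have : (1 - X : ℝ[X]).natDegree ≤ 1 :=
      (natDegree_sub_le _ _).trans (by simp)
    exact (Nat.mul_le_mul hQ this).trans_eq (mul_one n)
  have hQ'f : ∀ x ∈ Icc (1 / 3 : ℝ) 1, |f x - Q'.eval x| ≤ K * ε := by
    intro x hx
    have := hQf (1 - x) ⟨by linarith [hx.2], by linarith [hx.1]⟩
    simpa [Q', eval_comp] using this
  refine ⟨P, hP, fun x hx => ?_⟩
  have hKε : 0 ≤ K * ε := by positivity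
  by_cases hx3 : x ≤ 2 / 3
  · refine (hPf x ⟨hx.1, hx3⟩).trans ?_
    gcongr
    exact le_add_of_nonneg_right (by positivity)
  · have h1 := hQ'f x ⟨by linarith, hx.2⟩
    have h2 := g (Q' - P) (2 * K * ε) (1 / 3) (1 / 3) 2
      ((natDegree_sub_le_of_le hQ' hP).trans (max_self n).le)
      (by norm_num) (by norm_num) (fun v hv => by
        have m1 := hQ'f (1 / 3 + 1 / 3 * v) ⟨by linarith [hv.1], by linarith [hv.2]⟩
        have m2 := hPf (1 / 3 + 1 / 3 * v) ⟨by linarith [hv.1], by linarith [hv.2]⟩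
        rw [eval_sub]
        rw [abs_le] at *
        constructor <;> linarith [m1.1, m1.2, m2.1, m2.2]) x (by
        rw [abs_le]; norm_num; constructor <;> linarith [hx.2])
    rw [eval_sub] at h2
    calc _ = |(f x - Q'.eval x) + (Q'.eval x - P.eval x)| := by ring_nf
      _ ≤ K * ε + L * (2 * K * ε) * 2 ^ n := (abs_add_le _ _).trans (add_le_add h1 h2)
      _ = _ := by ring

/-- Whitney's inequality on a segment. -/
lemma whitney (n : ℕ) : ∃ K, 0 ≤ K ∧ ∀ (f : ℝ → ℝ) (ε a b : ℝ), a < b → 0 ≤ ε →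
    ContinuousOn f (Icc a b) →
    (∀ s y : ℝ, 0 < s → a ≤ y → y + ((n + 1 : ℕ) : ℝ) * s ≤ b → |fdiff (n + 1) s f y| ≤ ε) →
    ∃ P : ℝ[X], P.natDegree ≤ n ∧ ∀ x ∈ Icc a b, |f x - P.eval x| ≤ K * ε := by
  obtain ⟨K, hK, w⟩ := whitney_unit n
  refine ⟨K, hK, fun f ε a b hab hε hf h => ?_⟩
  have hba : 0 < b - a := sub_pos.mpr hab
  set F : ℝ → ℝ := fun v => f (a + (b - a) * max 0 (min 1 v)) with hF
  have hFv : ∀ v ∈ Icc (0 : ℝ) 1, F v = f (a + (b - a) * v) := fun v hv => by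
    simp [hF, min_eq_right hv.2, max_eq_right hv.1]
  have hFc : Continuous F := by
    refine hf.comp_continuous (by fun_prop) fun v => ?_
    have h0 : 0 ≤ max 0 (min 1 v) := le_max_left _ _
    have h1 : max 0 (min 1 v) ≤ 1 := max_le zero_le_one (min_le_left _ _)
    constructor <;> nlinarith
  obtain ⟨P, hP, hPF⟩ := w F ε hFc fun s y hs hy hsy => by
    rcases hs.eq_or_lt with rfl | hs
    · rw [fdiff_zero, abs_zero]; exact hε
    have e : fdiff (n + 1) s F y = fdiff (n + 1) ((b - a) * s) f (a + (b - a) * y) := by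
      refine Finset.sum_congr rfl fun k hk => ?_
      have hk' : (k : ℝ) ≤ (n + 1 : ℕ) := by
        exact_mod_cast Nat.lt_succ_iff.mp (Finset.mem_range.mp hk)
      have : (k : ℝ) * s ≤ (n + 1 : ℕ) * s := by gcongr
      rw [hFv _ ⟨by positivity, by linarith⟩]
      ring_nf
    rw [e]
    refine h _ _ (by positivity) (by nlinarith) ?_
    nlinarith
  refine ⟨P.comp (C (b - a)⁻¹ * (X - C a)), ?_, fun x hx => ?_⟩
  · refine natDegree_comp_le.trans ?_
    have : (C (b - a)⁻¹ * (X - C a)).natDegree ≤ 1 :=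
      (natDegree_C_mul_le _ _).trans (natDegree_X_sub_C_le a)
    exact (Nat.mul_le_mul hP this).trans_eq (mul_one n)
  · have hv : (b - a)⁻¹ * (x - a) ∈ Icc (0 : ℝ) 1 :=
      ⟨mul_nonneg (by positivity) (by linarith [hx.1]), by
        rw [inv_mul_le_iff₀ hba]; linarith [hx.2]⟩
    have := hPF _ hv
    rw [hFv _ hv, mul_inv_cancel_left₀ hba.ne', add_sub_cancel] at this
    simpa [eval_comp] using this

/-- The Bernstein operator as an endomorphism of the space of all functions. -/
noncomputable def bopLin (m : ℕ) : Module.End ℝ (ℝ → ℝ) where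
  toFun := Bop m
  map_add' f g := by
    funext x; simp [Bop, mul_add, Finset.sum_add_distrib]
  map_smul' a f := by
    funext x
    simp only [Bop, Pi.smul_apply, smul_eq_mul, RingHom.id_apply, Finset.mul_sum]
    exact Finset.sum_congr rfl fun k _ => by ring

lemma iterate_sub_Bop_eq (m l : ℕ) (f : ℝ → ℝ) :
    (fun g => g - Bop m g)^[l] f = ((1 - bopLin m) ^ l) f := by
  rw [Module.End.pow_apply]
  rfl

lemma one_sub_bopLin_pow_eval (m l : ℕ) (p : ℝ[X]) :
    ((1 - bopLin m) ^ l) (fun y => p.eval y)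
      = fun x => (((1 - bernPoly m : Module.End ℝ ℝ[X]) ^ l) p).eval x := by
  induction l generalizing p with
  | zero => rfl
  | succ l ih =>
    rw [pow_succ, pow_succ, Module.End.mul_apply, Module.End.mul_apply, ← ih]
    congr 1
    funext x
    simp only [LinearMap.sub_apply, Module.End.one_apply, eval_sub, eval_bernPoly]
    rfl

lemma one_add_bopLin_pow_eval (m l : ℕ) (p : ℝ[X]) :
    ((1 + bopLin m) ^ l) (fun y => p.eval y)
      = fun x => (((1 + bernPoly m : Module.End ℝ ℝ[X]) ^ l) p).eval x := by
  induction l generalizing p with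
  | zero => rfl
  | succ l ih =>
    rw [pow_succ, pow_succ, Module.End.mul_apply, Module.End.mul_apply, ← ih]
    congr 1
    funext x
    simp only [LinearMap.add_apply, Module.End.one_apply, eval_add, eval_bernPoly]
    rfl

lemma abs_Bop_le {m : ℕ} {h H : ℝ → ℝ} (hH : ∀ y ∈ Icc (0 : ℝ) 1, |h y| ≤ H y) :
    ∀ x ∈ Icc (0 : ℝ) 1, |Bop m h x| ≤ Bop m H x := by
  intro x hx
  refine (Finset.abs_sum_le_sum_abs _ _).trans (Finset.sum_le_sum fun k hk => ?_)
  have hb : 0 ≤ bern m k x :=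
    mul_nonneg (mul_nonneg (Nat.cast_nonneg _) (pow_nonneg hx.1 _))
      (pow_nonneg (by linarith [hx.2]) _)
  rw [abs_mul, abs_of_nonneg hb]
  refine mul_le_mul_of_nonneg_left (hH _ ⟨by positivity, ?_⟩) hb
  refine div_le_one_of_le₀ ?_ (Nat.cast_nonneg _)
  exact_mod_cast Nat.lt_succ_iff.mp (Finset.mem_range.mp hk)

lemma abs_one_sub_bopLin_pow_le {m : ℕ} (l : ℕ) {h H : ℝ → ℝ}
    (hH : ∀ y ∈ Icc (0 : ℝ) 1, |h y| ≤ H y) :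
    ∀ x ∈ Icc (0 : ℝ) 1, |((1 - bopLin m) ^ l) h x| ≤ ((1 + bopLin m) ^ l) H x := by
  induction l generalizing h H with
  | zero => exact hH
  | succ l ih =>
    rw [pow_succ, pow_succ, Module.End.mul_apply, Module.End.mul_apply]
    refine ih fun y hy => ?_
    exact (abs_sub _ _).trans (add_le_add (hH y hy) (abs_Bop_le hH y hy))

lemma exists_remainder_le (l k : ℕ) : ∃ K, 0 ≤ K ∧ ∀ m, ∀ x ∈ Icc (0 : ℝ) 1,
    ∀ (g : ℝ → ℝ) (A : ℝ), 0 ≤ A →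
    (∀ y ∈ Icc (0 : ℝ) 1, |g y| ≤ A * (1 + ((y - x) / (tt m * dd m x)) ^ k)) →
    |((1 - bopLin (m + 1)) ^ l) g x| ≤ K * A := by
  obtain ⟨K0, hK0, b0⟩ := exists_one_add_bernPoly_pow_le l 0
  obtain ⟨K, hK, b⟩ := exists_one_add_bernPoly_pow_le l k
  refine ⟨K0 + K, by positivity, fun m x hx g A hA hg => ?_⟩
  have hd : 0 < tt m * dd m x := mul_pos (tt_pos m) (dd_pos m x)
  set d := tt m * dd m x
  set H : ℝ[X] := A • ((X - C x) ^ 0 + (d ^ k)⁻¹ • (X - C x) ^ k) with hHdef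
  have hH : ∀ y ∈ Icc (0 : ℝ) 1, |g y| ≤ (fun y => H.eval y) y := by
    intro y hy
    refine (hg y hy).trans_eq ?_
    simp [hHdef, div_eq_inv_mul, mul_pow, mul_add]
  refine (abs_one_sub_bopLin_pow_le l hH x hx).trans ?_
  rw [one_add_bopLin_pow_eval, hHdef]
  simp only [map_smul, map_add, eval_smul, eval_add, smul_eq_mul]
  have h0 := (le_abs_self _).trans (b0 m x hx)
  have h1 := (le_abs_self _).trans (b m x hx)
  rw [pow_zero (tt m * dd m x), mul_one] at h0
  have h2 := mul_le_mul_of_nonneg_left h1 (inv_nonneg.mpr (pow_nonneg hd.le k))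
  have h3 : (d ^ k)⁻¹ * (K * d ^ k) = K := by field_simp
  rw [h3] at h2
  rw [mul_comm]
  exact mul_le_mul_of_nonneg_right (add_le_add h0 h2) hA

lemma exists_abs_one_sub_bopLin_eval_le (l n : ℕ) : ∃ K, 0 ≤ K ∧ ∀ m, ∀ x ∈ Icc (0 : ℝ) 1,
    ∀ (q : ℝ[X]) (A h : ℝ), q.natDegree ≤ n → h ≠ 0 →
    (∀ v ∈ Icc (0 : ℝ) 1, |q.eval (x + h * v)| ≤ A) →
    |((1 - bopLin (m + 1)) ^ (l + 1)) (fun y => q.eval y) x|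
      ≤ ∑ j ∈ Finset.range (n + 1), K * A / |h| ^ j *
          (tt m ^ (2 * (l + 1)) * dd m x ^ (2 * max 1 (j - (l + 1)))) := by
  obtain ⟨K, hK, b⟩ := exists_abs_coeff_taylor_le n
  choose c hc hcb using exists_one_sub_bernPoly_pow_le l
  have hc' : ∀ j ∈ Finset.range (n + 1), c j ≤ ∑ j ∈ Finset.range (n + 1), c j := fun j hj =>
    Finset.single_le_sum (fun i _ => hc i) hj
  have hS : 0 ≤ ∑ j ∈ Finset.range (n + 1), c j := Finset.sum_nonneg fun i _ => hc i
  set S := ∑ j ∈ Finset.range (n + 1), c j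
  refine ⟨K * S, by positivity, fun m x hx q A h hq hh hA => ?_⟩
  have hA0 : 0 ≤ A := (abs_nonneg _).trans (hA 0 (by simp))
  have ht := tt_pos m
  have hδ := dd_pos m x
  rw [one_sub_bopLin_pow_eval]
  conv_lhs => rw [eq_sum_taylor hq x]
  simp only [map_sum, ← smul_eq_C_mul, map_smul, eval_finsetSum, eval_smul, smul_eq_mul]
  refine (Finset.abs_sum_le_sum_abs _ _).trans (Finset.sum_le_sum fun j hj => ?_)
  rw [abs_mul]
  calc _ ≤ K * A / |h| ^ j * (S * (tt m ^ (2 * (l + 1)) * dd m x ^ (2 * max 1 (j - (l + 1))))) := by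
        refine mul_le_mul (b q A x h hq hh hA j) ((hcb j m x hx).trans ?_) (abs_nonneg _)
          (by positivity)
        exact mul_le_mul_of_nonneg_right (hc' j hj) (by positivity)
    _ = _ := by ring

/-- The step size, relative to `φ`, attached to the scale `D`. -/
noncomputable def mu (δ D : ℝ) : ℝ := Real.sqrt (D * min (D / δ ^ 2) 1)

lemma mu_nonneg (δ D : ℝ) : 0 ≤ mu δ D := Real.sqrt_nonneg _

lemma mu_sq {δ D : ℝ} (hD : 0 ≤ D) : mu δ D ^ 2 = D * min (D / δ ^ 2) 1 :=
  Real.sq_sqrt (mul_nonneg hD (le_min (by positivity) zero_le_one))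

lemma mu_mono {δ D E : ℝ} (hD : 0 ≤ D) (h : D ≤ E) : mu δ D ≤ mu δ E := by
  refine Real.sqrt_le_sqrt ?_
  have : 0 ≤ min (D / δ ^ 2) 1 := le_min (by positivity) zero_le_one
  have : 0 ≤ E := hD.trans h
  gcongr

lemma mu_two_mul_le {δ D : ℝ} (hD : 0 ≤ D) : mu δ (2 * D) ≤ 2 * mu δ D := by
  have h2 : 0 ≤ D / δ ^ 2 := by positivity
  refine le_of_sq_le_sq ?_ (by have := mu_nonneg δ D; positivity)
  rw [mul_pow, mu_sq hD, mu_sq (by positivity)]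
  have : min (2 * D / δ ^ 2) 1 ≤ 2 * min (D / δ ^ 2) 1 := by
    rw [mul_div_assoc]
    rcases min_cases (D / δ ^ 2) 1 with ⟨e, _⟩ | ⟨e, _⟩ <;> rw [e]
    · exact min_le_left _ _
    · exact (min_le_right _ _).trans (by norm_num)
  nlinarith

lemma mu_le_div {δ D : ℝ} (hδ : 0 < δ) (hD : 0 ≤ D) : mu δ D ≤ D / δ := by
  refine le_of_sq_le_sq ?_ (by positivity)
  rw [mu_sq hD, div_pow, sq D, mul_div_assoc]
  gcongr
  exact min_le_left _ _

lemma le_mu {t δ D : ℝ} (ht : 0 < t) (htδ : t ≤ δ) (hD : t * δ ≤ D) : t ≤ mu δ D := by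
  have hδ : 0 < δ := ht.trans_le htδ
  have hD0 : 0 < D := (mul_pos ht hδ).trans_le hD
  refine le_of_sq_le_sq ?_ (mu_nonneg _ _)
  rw [mu_sq hD0.le]
  rcases min_cases (D / δ ^ 2) 1 with ⟨e, _⟩ | ⟨e, _⟩ <;> rw [e]
  · rw [mul_div_assoc', le_div_iff₀ (by positivity)]
    nlinarith [mul_pos ht hδ]
  · nlinarith

lemma div_phiDT_le {m : ℕ} {x c s σ D : ℝ} (hx : x ∈ Icc (0 : ℝ) 1) (hs : 0 < s) (hσ : s ≤ σ)
    (h0 : 0 ≤ c - σ / 2) (h1 : c + σ / 2 ≤ 1) (hl : x - D ≤ c - σ / 2) (hr : c + σ / 2 ≤ x + D)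
    (hD : tt m * dd m x ≤ D) : s / phiDT c ≤ 4 * mu (dd m x) D := by
  have hδ := dd_pos m x
  have ht := tt_pos m
  have hD0 : 0 < D := (mul_pos ht hδ).trans_le hD
  have hc : c ∈ Icc (0 : ℝ) 1 := ⟨by linarith, by linarith⟩
  have hφ2 := phiDT_sq hc
  have hφ : 0 < phiDT c := Real.sqrt_pos.mpr (mul_pos (by linarith) (by linarith))
  have hsD : s ≤ 2 * D := by linarith
  have hsφ : s ≤ 4 * phiDT c ^ 2 := by
    rw [hφ2]
    rcases le_total c (1 / 2) with h | h <;> nlinarith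
  have ht2 : tt m ^ 2 ≤ D := by nlinarith [tt_le_dd m x]
  have hδφ : dd m x ^ 2 ≤ phiDT c ^ 2 + D := by
    rcases max_cases (phiDT x) (tt m) with ⟨e, _⟩ | ⟨e, _⟩
    · rw [dd, e, phiDT_sq hx, hφ2]
      rcases le_total x c with h | h
      · nlinarith [mul_nonneg (sub_nonneg.mpr h) hx.1, mul_nonneg (sub_nonneg.mpr h) hc.1]
      · nlinarith [mul_nonneg (sub_nonneg.mpr h) hx.1, mul_nonneg (sub_nonneg.mpr h) hc.1]
    · rw [dd, e]; nlinarith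
  rw [div_le_iff₀ hφ]
  refine le_of_sq_le_sq ?_ (by have := mu_nonneg (dd m x) D; positivity)
  rw [mul_pow, mul_pow, mu_sq hD0.le]
  rcases min_cases (D / dd m x ^ 2) 1 with ⟨e, _⟩ | ⟨e, _⟩ <;> rw [e]
  · rw [mul_div_assoc', mul_div_assoc', div_mul_eq_mul_div, le_div_iff₀ (by positivity)]
    have e1 : s ^ 2 * dd m x ^ 2 ≤ s ^ 2 * (phiDT c ^ 2 + D) := by gcongr
    have e2 : s ^ 2 ≤ (2 * D) ^ 2 := by gcongr
    have e3 : s ^ 2 * D ≤ 4 * phiDT c ^ 2 * (2 * D) * D := by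
      have : s * s ≤ 4 * phiDT c ^ 2 * (2 * D) := mul_le_mul hsφ hsD hs.le (by positivity)
      rw [sq]; gcongr
    nlinarith [mul_le_mul_of_nonneg_right e2 (sq_nonneg (phiDT c)),
      mul_nonneg (sq_nonneg D) (sq_nonneg (phiDT c))]
  · have : s * s ≤ 4 * phiDT c ^ 2 * (2 * D) := mul_le_mul hsφ hsD hs.le (by positivity)
    nlinarith [mul_nonneg (sq_nonneg (phiDT c)) hD0.le]

lemma exists_abs_le_of_continuousOn {f : ℝ → ℝ} (hf : ContinuousOn f (Icc 0 1)) :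
    ∃ B, ∀ y ∈ Icc (0 : ℝ) 1, |f y| ≤ B := by
  obtain ⟨B, hB⟩ := isCompact_Icc.exists_bound_of_continuousOn hf
  exact ⟨B, hB⟩

lemma omegaDT_nonneg (r : ℕ) (f : ℝ → ℝ) (t : ℝ) : 0 ≤ omegaDT r f t := by
  refine Real.sSup_nonneg ?_
  rintro y ⟨h, x, _, _, _, rfl⟩
  exact abs_nonneg _

lemma sSup_zygSet_nonneg (lam : ℝ) (r : ℕ) (f : ℝ → ℝ) : 0 ≤ sSup (zygSet lam r f) := by
  refine Real.sSup_nonneg ?_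
  rintro y ⟨t, ht, rfl⟩
  exact div_nonneg (omegaDT_nonneg _ _ _) (Real.rpow_nonneg ht.le _)

lemma abs_dtDiff_le {lam : ℝ} {r : ℕ} {f : ℝ → ℝ} (hf : memZ lam r f) {h x : ℝ} (hh : 0 < h)
    (hx : dtAdmissible r h x) : |dtDiff r h f x| ≤ sSup (zygSet lam r f) * h ^ lam := by
  obtain ⟨B, hB⟩ := exists_abs_le_of_continuousOn hf.1
  have hbdd : BddAbove {y | ∃ k x, 0 < k ∧ k ≤ h ∧ dtAdmissible r k x ∧ y = |dtDiff r k f x|} := by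
    refine ⟨∑ k ∈ Finset.range (r + 1), (r.choose k : ℝ) * B, ?_⟩
    rintro y ⟨k, z, _, _, hz, rfl⟩
    refine (Finset.abs_sum_le_sum_abs _ _).trans (Finset.sum_le_sum fun i hi => ?_)
    rw [abs_mul, abs_mul, abs_pow, abs_neg, abs_one, one_pow, one_mul, Nat.abs_cast]
    gcongr
    exact hB _ (hz.2 i (Nat.lt_succ_iff.mp (Finset.mem_range.mp hi)))
  have h1 : |dtDiff r h f x| ≤ omegaDT r f h := le_csSup hbdd ⟨h, x, hh, le_rfl, hx, rfl⟩
  have h2 : omegaDT r f h / h ^ lam ≤ sSup (zygSet lam r f) := le_csSup hf.2 ⟨h, hh, rfl⟩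
  exact h1.trans ((div_le_iff₀ (Real.rpow_pos_of_pos hh _)).mp h2)

lemma abs_fdiff_le {lam : ℝ} {l : ℕ} {f : ℝ → ℝ} (hl : 1 ≤ l) (hf : memZ lam (2 * l) f) {s y : ℝ}
    (hs : 0 < s) (hy : 0 ≤ y) (hys : y + ((2 * l : ℕ) : ℝ) * s ≤ 1) :
    |fdiff (2 * l) s f y| ≤ sSup (zygSet lam (2 * l) f) * (s / phiDT (y + l * s)) ^ lam := by
  have hl' : (1 : ℝ) ≤ l := by exact_mod_cast hl
  push_cast at hys
  have hls : 0 < l * s := by positivity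
  have hφ : 0 < phiDT (y + l * s) := Real.sqrt_pos.mpr (mul_pos (by linarith) (by linarith))
  have hnode : ∀ k : ℕ, y + l * s + (((2 * l : ℕ) : ℝ) - 2 * k) * (s / phiDT (y + l * s) / 2) *
      phiDT (y + l * s) = y + ((2 * l : ℕ) : ℝ) * s + k * (-s) := by
    intro k
    push_cast
    field_simp
    ring
  have e : dtDiff (2 * l) (s / phiDT (y + l * s)) f (y + l * s) = fdiff (2 * l) s f y := by
    have := fdiff_neg (2 * l) s f y
    rw [pow_mul, neg_one_sq, one_pow, one_mul] at this
    rw [← this]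
    exact Finset.sum_congr rfl fun k _ => by rw [hnode]
  rw [← e]
  refine abs_dtDiff_le hf (by positivity) ⟨⟨by linarith, by linarith⟩, fun k hk => ?_⟩
  have hk' : (k : ℝ) ≤ 2 * l := by exact_mod_cast hk
  rw [hnode]
  push_cast
  constructor <;> nlinarith [Nat.cast_nonneg (α := ℝ) k]

lemma exists_local_poly (l : ℕ) {lam : ℝ} (hlam : 0 < lam) : ∃ K, 0 ≤ K ∧
    ∀ f : ℝ → ℝ, memZ lam (2 * (l + 1)) f → ∀ m, ∀ x ∈ Icc (0 : ℝ) 1, ∀ D, tt m * dd m x ≤ D →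
    ∃ P : ℝ[X], P.natDegree ≤ 2 * l + 1 ∧ ∀ y ∈ Icc (0 : ℝ) 1, |y - x| ≤ D →
      |f y - P.eval y| ≤ K * (sSup (zygSet lam (2 * (l + 1)) f) * mu (dd m x) D ^ lam) := by
  obtain ⟨K, hK, w⟩ := whitney (2 * l + 1)
  refine ⟨K * 4 ^ lam, by positivity, fun f hf m x hx D hD => ?_⟩
  have hD0 : 0 < D := (mul_pos (tt_pos m) (dd_pos m x)).trans_le hD
  have hμ := mu_nonneg (dd m x) D
  have hM := sSup_zygSet_nonneg lam (2 * (l + 1)) f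
  set M := sSup (zygSet lam (2 * (l + 1)) f)
  obtain ⟨P, hP, hPf⟩ := w f (M * (4 * mu (dd m x) D) ^ lam) (max 0 (x - D)) (min 1 (x + D))
    (by
      have := hx.1
      have := hx.2
      refine max_lt (lt_min ?_ ?_) (lt_min ?_ ?_) <;> linarith)
    (by positivity)
    (hf.1.mono (Icc_subset_Icc (le_max_left _ _) (min_le_left _ _)))
    (fun s y hs hy hys => by
      have hy0 := (le_max_left _ _).trans hy
      have hy1 := (le_max_right _ _).trans hy
      have hz0 := hys.trans (min_le_left _ _)
      have hz1 := hys.trans (min_le_right _ _)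
      refine (abs_fdiff_le (l := l + 1) (by omega) hf hs hy0 hz0).trans ?_
      refine mul_le_mul_of_nonneg_left (Real.rpow_le_rpow
        (div_nonneg hs.le (Real.sqrt_nonneg _)) ?_ hlam.le) hM
      push_cast at hz0 hz1 ⊢
      have hl0 : (0 : ℝ) ≤ l := Nat.cast_nonneg l
      refine div_phiDT_le (σ := 2 * (l + 1) * s) hx hs ?_ ?_ ?_ ?_ ?_ hD <;> nlinarith)
  refine ⟨P, hP, fun y hy hyx => (hPf y ⟨max_le hy.1 ?_, le_min hy.2 ?_⟩).trans_eq ?_⟩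
  · linarith [(abs_le.mp hyx).1]
  · linarith [(abs_le.mp hyx).2]
  · rw [Real.mul_rpow (by norm_num) hμ]; ring

lemma exists_segment {x D : ℝ} (hx : x ∈ Icc (0 : ℝ) 1) (hD : 0 < D) (hD1 : D ≤ 1) :
    ∃ h : ℝ, h ≠ 0 ∧ |h| = D / 2 ∧
      ∀ v ∈ Icc (0 : ℝ) 1, x + h * v ∈ Icc (0 : ℝ) 1 ∧ |x + h * v - x| ≤ D := by
  have hv : ∀ h : ℝ, |h| = D / 2 → ∀ v ∈ Icc (0 : ℝ) 1, |x + h * v - x| ≤ D := by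
    intro h hh v hv
    rw [add_sub_cancel_left, abs_mul, hh, abs_of_nonneg hv.1]
    nlinarith [hv.2]
  rcases le_total x (1 / 2) with h | h
  · have e : |D / 2| = D / 2 := abs_of_pos (by positivity)
    refine ⟨D / 2, by positivity, e, fun v hv' => ⟨⟨?_, ?_⟩, hv _ e v hv'⟩⟩
    · nlinarith [hx.1, hv'.1]
    · nlinarith [hv'.2]
  · have e : |-(D / 2)| = D / 2 := by rw [abs_neg]; exact abs_of_pos (by positivity)
    refine ⟨-(D / 2), by simpa using hD.ne', e, fun v hv' => ⟨⟨?_, ?_⟩, hv _ e v hv'⟩⟩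
    · nlinarith [hv'.2]
    · nlinarith [hx.2, hv'.1]

lemma pow_mul_rpow_le {t μ lam : ℝ} {n : ℕ} (ht : 0 < t) (hμ : t ≤ μ) (hn : lam ≤ n) :
    t ^ n * μ ^ lam ≤ t ^ lam * μ ^ n := by
  have hμ0 : 0 < μ := ht.trans_le hμ
  have h : ∀ z : ℝ, 0 < z → z ^ n = z ^ lam * z ^ ((n : ℝ) - lam) := fun z hz => by
    rw [← Real.rpow_add hz, add_sub_cancel, Real.rpow_natCast]
  rw [h t ht, h μ hμ0]
  have : t ^ ((n : ℝ) - lam) ≤ μ ^ ((n : ℝ) - lam) :=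
    Real.rpow_le_rpow ht.le hμ (by linarith)
  calc _ = t ^ lam * μ ^ lam * t ^ ((n : ℝ) - lam) := by ring
    _ ≤ t ^ lam * μ ^ lam * μ ^ ((n : ℝ) - lam) := by gcongr
    _ = _ := by ring

lemma scale_le {D δ : ℝ} {l j : ℕ} (hD : 0 < D) (hD1 : D ≤ 1) (hδ : 0 < δ) (hδ1 : δ ≤ 1)
    (hj : j ≤ 2 * l + 1) :
    (D * min (D / δ ^ 2) 1) ^ (l + 1) * δ ^ (2 * max 1 (j - (l + 1)))
      ≤ D ^ j * min (D / δ ^ 2) (δ ^ 2 / D) := by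
  rw [pow_mul]
  have he : 0 < δ ^ 2 := by positivity
  have he1 : δ ^ 2 ≤ 1 := pow_le_one₀ hδ.le hδ1
  generalize δ ^ 2 = e at *
  rcases le_total D e with h | h
  · have hv1 : D / e ≤ 1 := (div_le_one he).mpr h
    have hv1' : 1 ≤ e / D := (one_le_div hD).mpr h
    rw [min_eq_left hv1, min_eq_left (hv1.trans hv1')]
    have hDe : D = D / e * e := by field_simp
    have hv : 0 < D / e := by positivity
    generalize D / e = v at *
    rcases le_or_gt j (l + 1) with hjl | hjl
    · rw [Nat.sub_eq_zero_of_le hjl, max_eq_left (Nat.zero_le 1), pow_one, mul_pow]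
      calc D ^ (l + 1) * v ^ (l + 1) * e ≤ D ^ j * v ^ 1 * 1 :=
            mul_le_mul (mul_le_mul (pow_le_pow_of_le_one hD.le hD1 hjl)
              (pow_le_pow_of_le_one hv.le hv1 (by omega)) (by positivity) (by positivity)) he1
              he.le (by positivity)
        _ = _ := by ring
    · obtain ⟨i, rfl⟩ := Nat.exists_eq_add_of_lt hjl
      rw [show l + 1 + i + 1 - (l + 1) = i + 1 by omega, max_eq_right (by omega), mul_pow,
        show l + 1 + i + 1 = (l + 1) + (i + 1) by omega, pow_add D (l + 1), mul_assoc, mul_assoc]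
      refine mul_le_mul_of_nonneg_left ?_ (pow_nonneg hD.le _)
      calc v ^ (l + 1) * e ^ (i + 1) ≤ v ^ (i + 1 + 1) * e ^ (i + 1) := by
            refine mul_le_mul_of_nonneg_right (pow_le_pow_of_le_one hv.le hv1 (by omega))
              (by positivity)
        _ = _ := by rw [hDe]; ring
  · have hv1 : 1 ≤ D / e := (one_le_div he).mpr h
    have hv1' : e / D ≤ 1 := (div_le_one hD).mpr h
    rw [min_eq_right hv1, min_eq_right (hv1'.trans hv1), mul_one]
    have hDe : e = e / D * D := by field_simp
    have hw : 0 < e / D := by positivity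
    generalize e / D = w at *
    rcases le_or_gt j (l + 1) with hjl | hjl
    · rw [Nat.sub_eq_zero_of_le hjl, max_eq_left (Nat.zero_le 1), pow_one]
      calc D ^ (l + 1) * e = D ^ (l + 1 + 1) * w := by rw [hDe]; ring
        _ ≤ _ := mul_le_mul_of_nonneg_right
            (pow_le_pow_of_le_one hD.le hD1 (by omega)) hw.le
    · obtain ⟨i, rfl⟩ := Nat.exists_eq_add_of_lt hjl
      rw [show l + 1 + i + 1 - (l + 1) = i + 1 by omega, max_eq_right (by omega),
        show l + 1 + i + 1 = (l + 1) + (i + 1) by omega, pow_add D (l + 1), mul_assoc]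
      refine mul_le_mul_of_nonneg_left ?_ (pow_nonneg hD.le _)
      calc e ^ (i + 1) = w ^ (i + 1) * D ^ (i + 1) := by rw [← mul_pow, ← hDe]
        _ ≤ w ^ 1 * D ^ (i + 1) := by
            refine mul_le_mul_of_nonneg_right (pow_le_pow_of_le_one hw.le hv1' (by omega))
              (by positivity)
        _ = _ := by ring

lemma sum_min_dyadic_le {v : ℝ} (hv : 0 < v) (N : ℕ) :
    ∑ k ∈ Finset.range N, min (2 ^ k * v) (2 ^ k * v)⁻¹ ≤ 6 := by
  set ψ : ℕ → ℝ := fun k => 6 * (2 ^ k * v / (1 + 2 ^ k * v)) with hψ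
  have h : ∀ k ∈ Finset.range N, min (2 ^ k * v) (2 ^ k * v)⁻¹ ≤ ψ (k + 1) - ψ k := by
    intro k _
    simp only [hψ]
    rw [pow_succ, mul_right_comm _ (2 : ℝ)]
    have hw : 0 < 2 ^ k * v := by positivity
    generalize 2 ^ k * v = w at *
    have e : 6 * (w * 2 / (1 + w * 2)) - 6 * (w / (1 + w))
        = 6 * w / ((1 + w * 2) * (1 + w)) := by field_simp; ring
    rw [e, le_div_iff₀ (by positivity)]
    rcases le_total w 1 with h | h
    · refine (mul_le_mul_of_nonneg_right (min_le_left _ _) (by positivity)).trans ?_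
      have : (1 + w * 2) * (1 + w) ≤ 6 := by nlinarith
      nlinarith
    · refine (mul_le_mul_of_nonneg_right (min_le_right _ _) (by positivity)).trans ?_
      rw [inv_mul_le_iff₀ hw]
      nlinarith
  refine (Finset.sum_le_sum h).trans ?_
  rw [Finset.sum_range_sub]
  have h1 : ψ N ≤ 6 := by
    simp only [hψ]
    have : 2 ^ N * v / (1 + 2 ^ N * v) ≤ 1 := (div_le_one (by positivity)).mpr (by linarith)
    linarith
  have h0 : 0 ≤ ψ 0 := by positivity
  linarith

lemma exists_step_le (l : ℕ) {lam : ℝ} (hlam : lam ≤ 2 * ((l + 1 : ℕ) : ℝ)) : ∃ K, 0 ≤ K ∧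
    ∀ m, ∀ x ∈ Icc (0 : ℝ) 1, ∀ (q : ℝ[X]) (A D : ℝ), q.natDegree ≤ 2 * l + 1 →
    tt m * dd m x ≤ D → D ≤ 1 →
    (∀ y ∈ Icc (0 : ℝ) 1, |y - x| ≤ D → |q.eval y| ≤ A * mu (dd m x) D ^ lam) →
    |((1 - bopLin (m + 1)) ^ (l + 1)) (fun y => q.eval y) x|
      ≤ K * (A * tt m ^ lam) * min (D / dd m x ^ 2) (dd m x ^ 2 / D) := by
  obtain ⟨K, hK, b⟩ := exists_abs_one_sub_bopLin_eval_le l (2 * l + 1)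
  refine ⟨K * ∑ j ∈ Finset.range (2 * l + 1 + 1), 2 ^ j, by positivity,
    fun m x hx q A D hq hD hD1 hA => ?_⟩
  have hδ := dd_pos m x
  have ht := tt_pos m
  have hD0 : 0 < D := (mul_pos ht hδ).trans_le hD
  have hμt := le_mu ht (tt_le_dd m x) hD
  have hμ0 : 0 < mu (dd m x) D := ht.trans_le hμt
  obtain ⟨h, hh, hhD, hseg⟩ := exists_segment hx hD0 hD1
  have hA0 : 0 ≤ A := by
    have := (abs_nonneg _).trans (hA x hx (by simpa using hD0.le))
    exact nonneg_of_mul_nonneg_left this (by positivity)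
  refine (b m x hx q (A * mu (dd m x) D ^ lam) h hq hh
    (fun v hv => hA _ (hseg v hv).1 (hseg v hv).2)).trans ?_
  rw [mul_assoc, mul_assoc, Finset.sum_mul, Finset.mul_sum]
  refine Finset.sum_le_sum fun j hj => ?_
  have hj' : j ≤ 2 * l + 1 := Nat.lt_succ_iff.mp (Finset.mem_range.mp hj)
  have h1 : tt m ^ (2 * (l + 1)) * mu (dd m x) D ^ lam
      ≤ tt m ^ lam * (D * min (D / dd m x ^ 2) 1) ^ (l + 1) := by
    refine (pow_mul_rpow_le ht hμt (by push_cast at hlam ⊢; exact hlam)).trans_eq ?_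
    rw [pow_mul (mu (dd m x) D), mu_sq hD0.le]
  have h2 := scale_le hD0 hD1 hδ (dd_le_one m x) hj'
  set w := min (D / dd m x ^ 2) (dd m x ^ 2 / D)
  set u := D * min (D / dd m x ^ 2) 1
  calc _ = K * A * 2 ^ j / D ^ j * ((tt m ^ (2 * (l + 1)) * mu (dd m x) D ^ lam) *
          dd m x ^ (2 * max 1 (j - (l + 1)))) := by
        rw [hhD, div_pow]; field_simp
    _ ≤ K * A * 2 ^ j / D ^ j * ((tt m ^ lam * u ^ (l + 1)) *
          dd m x ^ (2 * max 1 (j - (l + 1)))) := by gcongr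
    _ = K * A * 2 ^ j / D ^ j * (tt m ^ lam * (u ^ (l + 1) *
          dd m x ^ (2 * max 1 (j - (l + 1))))) := by ring
    _ ≤ K * A * 2 ^ j / D ^ j * (tt m ^ lam * (D ^ j * w)) := by gcongr
    _ = _ := by field_simp

lemma exists_top_le (l : ℕ) {lam : ℝ} (hlam : lam ≤ 2 * ((l + 1 : ℕ) : ℝ)) : ∃ K, 0 ≤ K ∧
    ∀ m, ∀ x ∈ Icc (0 : ℝ) 1, ∀ (q : ℝ[X]) (A : ℝ), q.natDegree ≤ 2 * l + 1 →
    (∀ y ∈ Icc (0 : ℝ) 1, |q.eval y| ≤ A) →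
    |((1 - bopLin (m + 1)) ^ (l + 1)) (fun y => q.eval y) x| ≤ K * (A * tt m ^ lam) := by
  obtain ⟨K, hK, b⟩ := exists_abs_one_sub_bopLin_eval_le l (2 * l + 1)
  refine ⟨K * ∑ j ∈ Finset.range (2 * l + 1 + 1), 2 ^ j, by positivity,
    fun m x hx q A hq hA => ?_⟩
  have hδ := dd_pos m x
  have ht := tt_pos m
  obtain ⟨h, hh, hhD, hseg⟩ := exists_segment hx one_pos le_rfl
  have hA0 : 0 ≤ A := (abs_nonneg _).trans (hA x hx)
  refine (b m x hx q A h hq hh (fun v hv => hA _ (hseg v hv).1)).trans ?_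
  rw [mul_assoc, Finset.sum_mul, Finset.mul_sum]
  refine Finset.sum_le_sum fun j _ => ?_
  have h1 : tt m ^ (2 * (l + 1)) ≤ tt m ^ lam := by
    rw [← Real.rpow_natCast]
    exact Real.rpow_le_rpow_of_exponent_ge ht (tt_le_one m) (by push_cast at hlam ⊢; exact hlam)
  calc _ ≤ K * A / |h| ^ j * (tt m ^ lam * 1) := by
        gcongr
        exact pow_le_one₀ hδ.le (dd_le_one m x)
    _ = _ := by rw [hhD, div_pow, one_pow]; field_simp

lemma exists_near_le (l : ℕ) {lam K₀ : ℝ} (hlam0 : 0 < lam) (hK₀ : 0 ≤ K₀)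
    (hlam : lam ≤ 2 * ((l + 1 : ℕ) : ℝ))
    (hloc : ∀ f : ℝ → ℝ, memZ lam (2 * (l + 1)) f → ∀ m, ∀ x ∈ Icc (0 : ℝ) 1, ∀ D,
      tt m * dd m x ≤ D → ∃ P : ℝ[X], P.natDegree ≤ 2 * l + 1 ∧
        ∀ y ∈ Icc (0 : ℝ) 1, |y - x| ≤ D →
          |f y - P.eval y| ≤ K₀ * (sSup (zygSet lam (2 * (l + 1)) f) * mu (dd m x) D ^ lam)) :
    ∃ K, 0 ≤ K ∧ ∀ f : ℝ → ℝ, memZ lam (2 * (l + 1)) f → ∀ m, ∀ x ∈ Icc (0 : ℝ) 1, ∀ P : ℝ[X],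
      P.natDegree ≤ 2 * l + 1 →
      (∀ y ∈ Icc (0 : ℝ) 1, |y - x| ≤ tt m * dd m x → |f y - P.eval y| ≤
        K₀ * (sSup (zygSet lam (2 * (l + 1)) f) * mu (dd m x) (tt m * dd m x) ^ lam)) →
      ∀ y ∈ Icc (0 : ℝ) 1, |f y - P.eval y| ≤
        K * (sSup (zygSet lam (2 * (l + 1)) f) * tt m ^ lam) *
          (1 + ((y - x) / (tt m * dd m x)) ^ (4 * (l + 1))) := by
  obtain ⟨K, hK, g⟩ := exists_abs_eval_le (2 * l + 1)
  refine ⟨K₀ + K * (2 * K₀) * 2 ^ (2 * l + 1), by positivity, fun f hf m x hx P hP hPf y hy => ?_⟩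
  have hδ := dd_pos m x
  have ht := tt_pos m
  have hd : 0 < tt m * dd m x := mul_pos ht hδ
  have hd1 : tt m * dd m x ≤ 1 := mul_le_one₀ (tt_le_one m) hδ.le (dd_le_one m x)
  have hM := sSup_zygSet_nonneg lam (2 * (l + 1)) f
  set M := sSup (zygSet lam (2 * (l + 1)) f)
  set d := tt m * dd m x with hdd
  set D := max d |y - x| with hDdef
  have hdD : d ≤ D := le_max_left _ _
  have hyD : |y - x| ≤ D := le_max_right _ _
  have hD0 : 0 < D := hd.trans_le hdD
  obtain ⟨Q, hQ, hQf⟩ := hloc f hf m x hx D hdD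
  obtain ⟨h, hh, hhd, hseg⟩ := exists_segment hx hd hd1
  have hμ0 := mu_nonneg (dd m x) D
  have hμ : mu (dd m x) d ^ lam ≤ mu (dd m x) D ^ lam :=
    Real.rpow_le_rpow (mu_nonneg _ _) (mu_mono hd.le hdD) hlam0.le
  have hR : 1 ≤ D / d := (one_le_div hd).mpr hdD
  have hbd : ∀ v ∈ Icc (0 : ℝ) 1,
      |(Q - P).eval (x + h * v)| ≤ 2 * K₀ * (M * mu (dd m x) D ^ lam) := by
    intro v hv
    obtain ⟨hs1, hs2⟩ := hseg v hv
    have m1 := hPf _ hs1 hs2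
    have m2 := hQf _ hs1 (hs2.trans hdD)
    have m3 : K₀ * (M * mu (dd m x) d ^ lam) ≤ K₀ * (M * mu (dd m x) D ^ lam) := by gcongr
    rw [eval_sub]
    rw [abs_le] at *
    constructor <;> linarith [m1.1, m1.2, m2.1, m2.2]
  have h1 := g (Q - P) _ x h (2 * (D / d)) ((natDegree_sub_le_of_le hQ hP).trans (max_self _).le)
    hh (by linarith) hbd y (by
      rw [hhd]
      refine hyD.trans_eq ?_
      field_simp)
  have h2 := hQf y hy hyD
  have h3 : mu (dd m x) D ^ lam ≤ tt m ^ lam * (D / d) ^ (2 * (l + 1)) := by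
    have e : D / dd m x = tt m * (D / d) := by rw [hdd]; field_simp
    calc mu (dd m x) D ^ lam ≤ (tt m * (D / d)) ^ lam := by
          rw [← e]
          exact Real.rpow_le_rpow hμ0 (mu_le_div hδ hD0.le) hlam0.le
      _ = tt m ^ lam * (D / d) ^ lam := Real.mul_rpow ht.le (by positivity)
      _ ≤ _ := by
          gcongr
          rw [← Real.rpow_natCast]
          exact Real.rpow_le_rpow_of_exponent_le hR (by push_cast at hlam ⊢; exact hlam)
  have h4 : (D / d) ^ (4 * (l + 1)) ≤ 1 + ((y - x) / d) ^ (4 * (l + 1)) := by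
    have hev : 0 ≤ ((y - x) / d) ^ (4 * (l + 1)) :=
      Even.pow_nonneg ⟨2 * (l + 1), by ring⟩ _
    rcases max_cases d |y - x| with ⟨e, _⟩ | ⟨e, _⟩
    · rw [hDdef, e, div_self hd.ne', one_pow]; linarith
    · have : (|y - x| / d) ^ (4 * (l + 1)) = ((y - x) / d) ^ (4 * (l + 1)) := by
        rw [div_pow, div_pow, Even.pow_abs ⟨2 * (l + 1), by ring⟩]
      rw [hDdef, e, this]; linarith
  have h5 : mu (dd m x) D ^ lam * (D / d) ^ (2 * l + 1)
      ≤ tt m ^ lam * (D / d) ^ (4 * (l + 1)) := by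
    calc _ ≤ tt m ^ lam * (D / d) ^ (2 * (l + 1)) * (D / d) ^ (2 * l + 1) := by gcongr
      _ = tt m ^ lam * (D / d) ^ (2 * (l + 1) + (2 * l + 1)) := by rw [mul_assoc, ← pow_add]
      _ ≤ _ := by
        refine mul_le_mul_of_nonneg_left (pow_le_pow_right₀ hR (by omega)) (by positivity)
  have h6 : 1 ≤ (D / d) ^ (2 * l + 1) := one_le_pow₀ hR
  rw [eval_sub] at h1
  calc |f y - P.eval y| = |(f y - Q.eval y) + (Q.eval y - P.eval y)| := by ring_nf
    _ ≤ K₀ * (M * mu (dd m x) D ^ lam) +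
        K * (2 * K₀ * (M * mu (dd m x) D ^ lam)) * (2 * (D / d)) ^ (2 * l + 1) :=
        (abs_add_le _ _).trans (add_le_add h2 h1)
    _ ≤ K₀ * (M * mu (dd m x) D ^ lam) * (D / d) ^ (2 * l + 1) +
        K * (2 * K₀ * (M * mu (dd m x) D ^ lam)) * (2 * (D / d)) ^ (2 * l + 1) := by
        refine add_le_add_left ?_ _
        exact le_mul_of_one_le_right (by positivity) h6
    _ = (K₀ + K * (2 * K₀) * 2 ^ (2 * l + 1)) * M *
        (mu (dd m x) D ^ lam * (D / d) ^ (2 * l + 1)) := by rw [mul_pow]; ring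
    _ ≤ (K₀ + K * (2 * K₀) * 2 ^ (2 * l + 1)) * M *
        (tt m ^ lam * (1 + ((y - x) / d) ^ (4 * (l + 1)))) := by
        refine mul_le_mul_of_nonneg_left (h5.trans ?_) (by positivity)
        exact mul_le_mul_of_nonneg_left h4 (by positivity)
    _ = _ := by ring

lemma abs_le_supNorm {f : ℝ → ℝ} (hf : ContinuousOn f (Icc 0 1)) {y : ℝ}
    (hy : y ∈ Icc (0 : ℝ) 1) : |f y| ≤ supNorm f := by
  obtain ⟨B, hB⟩ := exists_abs_le_of_continuousOn hf
  have hbdd : BddAbove (range fun z : Icc (0 : ℝ) 1 => |f z|) := by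
    refine ⟨B, ?_⟩
    rintro _ ⟨z, rfl⟩
    exact hB z z.2
  exact le_ciSup hbdd ⟨y, hy⟩

lemma exists_abs_one_sub_bopLin_pow_le (l : ℕ) {lam : ℝ} (hlam0 : 0 < lam)
    (hlam : lam ≤ 2 * ((l + 1 : ℕ) : ℝ)) : ∃ K, 0 ≤ K ∧
    ∀ f : ℝ → ℝ, memZ lam (2 * (l + 1)) f → ∀ m, ∀ x ∈ Icc (0 : ℝ) 1,
      |((1 - bopLin (m + 1)) ^ (l + 1)) f x| ≤ K * (Znorm lam (2 * (l + 1)) f * tt m ^ lam) := by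
  obtain ⟨K₀, hK₀, hloc⟩ := exists_local_poly l hlam0
  obtain ⟨K₁, hK₁, hnear⟩ := exists_near_le l hlam0 hK₀ hlam hloc
  obtain ⟨K₂, hK₂, hrem⟩ := exists_remainder_le (l + 1) (4 * (l + 1))
  obtain ⟨K₃, hK₃, hstep⟩ := exists_step_le l hlam
  obtain ⟨K₄, hK₄, htop⟩ := exists_top_le l hlam
  refine ⟨K₂ * K₁ + K₃ * (K₀ * (1 + 2 ^ lam)) * 6 + K₄ * (1 + K₀ * 2 ^ lam), by positivity,
    fun f hf m x hx => ?_⟩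
  have hδ := dd_pos m x
  have ht := tt_pos m
  have hd : 0 < tt m * dd m x := mul_pos ht hδ
  have hd1 : tt m * dd m x ≤ 1 := mul_le_one₀ (tt_le_one m) hδ.le (dd_le_one m x)
  have hM := sSup_zygSet_nonneg lam (2 * (l + 1)) f
  have hS : 0 ≤ supNorm f := (abs_nonneg _).trans (abs_le_supNorm hf.1 hx)
  rw [Znorm]
  set S := supNorm f
  set M := sSup (zygSet lam (2 * (l + 1)) f)
  set δ := dd m x
  set d := tt m * δ with hddef
  have hD : ∀ k : ℕ, d ≤ 2 ^ k * d := fun k =>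
    le_mul_of_one_le_left hd.le (one_le_pow₀ (by norm_num))
  choose P hP hPf using fun k : ℕ => hloc f hf m x hx (2 ^ k * d) (hD k)
  obtain ⟨N, hN1, hN2⟩ := exists_nat_pow_near (one_le_inv₀ hd |>.mpr hd1) (one_lt_two (α := ℝ))
  have hDle : ∀ k ≤ N, 2 ^ k * d ≤ 1 := fun k hk =>
    calc 2 ^ k * d ≤ 2 ^ N * d := by gcongr; norm_num
      _ ≤ d⁻¹ * d := by gcongr
      _ = 1 := inv_mul_cancel₀ hd.ne'
  have hDtop : 1 ≤ 2 ^ (N + 1) * d :=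
    calc 1 = d⁻¹ * d := (inv_mul_cancel₀ hd.ne').symm
      _ ≤ _ := by gcongr
  set T := ((1 - bopLin (m + 1)) ^ (l + 1))
  have hsplit : f = (f - fun y => (P 0).eval y)
      + ∑ k ∈ Finset.range (N + 1), (fun y => (P k - P (k + 1)).eval y)
      + fun y => (P (N + 1)).eval y := by
    funext y
    have := Finset.sum_range_sub' (fun k => (P k).eval y) (N + 1)
    simp only [Pi.add_apply, Pi.sub_apply, Finset.sum_apply, eval_sub, this]
    ring
  have h1 : |T (f - fun y => (P 0).eval y) x| ≤ K₂ * (K₁ * (M * tt m ^ lam)) := by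
    refine hrem m x hx _ _ (by positivity) ?_
    refine hnear f hf m x hx (P 0) (hP 0) fun y hy hyx => ?_
    have := hPf 0 y hy (by rwa [pow_zero, one_mul])
    rwa [pow_zero, one_mul] at this
  have h2 : ∀ k ∈ Finset.range (N + 1), |T (fun y => (P k - P (k + 1)).eval y) x|
      ≤ K₃ * (K₀ * (1 + 2 ^ lam) * M * tt m ^ lam) *
        min (2 ^ k * (d / δ ^ 2)) (2 ^ k * (d / δ ^ 2))⁻¹ := by
    intro k hk
    have hk' : k ≤ N := Nat.lt_succ_iff.mp (Finset.mem_range.mp hk)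
    have hDk : 0 < 2 ^ k * d := by positivity
    have := hstep m x hx (P k - P (k + 1)) (K₀ * (1 + 2 ^ lam) * M) (2 ^ k * d)
      ((natDegree_sub_le_of_le (hP k) (hP (k + 1))).trans (max_self _).le) (hD k) (hDle k hk')
      (fun y hy hyx => by
        have m1 := hPf k y hy hyx
        have m2 := hPf (k + 1) y hy (hyx.trans (by rw [pow_succ]; linarith))
        have m3 : mu δ (2 ^ (k + 1) * d) ^ lam ≤ 2 ^ lam * mu δ (2 ^ k * d) ^ lam := by
          rw [← Real.mul_rpow (by norm_num) (mu_nonneg _ _), pow_succ', mul_assoc]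
          exact Real.rpow_le_rpow (mu_nonneg _ _) (mu_two_mul_le hDk.le) hlam0.le
        rw [eval_sub]
        calc |(P k).eval y - (P (k + 1)).eval y|
            = |(f y - (P (k + 1)).eval y) - (f y - (P k).eval y)| := by ring_nf
          _ ≤ K₀ * (M * mu δ (2 ^ (k + 1) * d) ^ lam) + K₀ * (M * mu δ (2 ^ k * d) ^ lam) :=
            (abs_sub _ _).trans (add_le_add m2 m1)
          _ ≤ K₀ * (M * (2 ^ lam * mu δ (2 ^ k * d) ^ lam)) +
              K₀ * (M * mu δ (2 ^ k * d) ^ lam) := by gcongr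
          _ = _ := by ring)
    rw [← mul_div_assoc, inv_div]
    exact this
  have h3 : |T (fun y => (P (N + 1)).eval y) x| ≤ K₄ * ((S + K₀ * (M * 2 ^ lam)) * tt m ^ lam) := by
    refine htop m x hx _ _ (hP _) fun y hy => ?_
    have m1 := hPf (N + 1) y hy ((abs_sub_le_iff.mpr
      ⟨by linarith [hy.2, hx.1], by linarith [hy.1, hx.2]⟩).trans hDtop)
    have m2 := abs_le_supNorm hf.1 hy
    have m3 : mu δ (2 ^ (N + 1) * d) ≤ 2 := by
      refine le_of_sq_le_sq ?_ (by norm_num)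
      rw [mu_sq (by positivity)]
      have e1 : min (2 ^ (N + 1) * d / δ ^ 2) 1 ≤ 1 := min_le_right _ _
      have e2 : 2 ^ (N + 1) * d ≤ 2 := by rw [pow_succ']; linarith [hDle N le_rfl]
      have e3 : 0 < 2 ^ (N + 1) * d := by positivity
      nlinarith
    calc |(P (N + 1)).eval y| = |f y - (f y - (P (N + 1)).eval y)| := by ring_nf
      _ ≤ S + K₀ * (M * mu δ (2 ^ (N + 1) * d) ^ lam) := (abs_sub _ _).trans (add_le_add m2 m1)
      _ ≤ _ := by
        gcongr
        exact mu_nonneg _ _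
  have h4 : |∑ k ∈ Finset.range (N + 1), T (fun y => (P k - P (k + 1)).eval y) x|
      ≤ K₃ * (K₀ * (1 + 2 ^ lam) * M * tt m ^ lam) * 6 := by
    refine (Finset.abs_sum_le_sum_abs _ _).trans ((Finset.sum_le_sum h2).trans ?_)
    rw [← Finset.mul_sum]
    gcongr
    exact sum_min_dyadic_le (by positivity) _
  have hTf : T f x = T (f - fun y => (P 0).eval y) x
      + ∑ k ∈ Finset.range (N + 1), T (fun y => (P k - P (k + 1)).eval y) x
      + T (fun y => (P (N + 1)).eval y) x := by
    conv_lhs => rw [hsplit]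
    simp only [map_add, map_sum, Pi.add_apply, Finset.sum_apply]
  have htl : 0 < tt m ^ lam := by positivity
  rw [hTf]
  calc _ ≤ K₂ * (K₁ * (M * tt m ^ lam)) + K₃ * (K₀ * (1 + 2 ^ lam) * M * tt m ^ lam) * 6
        + K₄ * ((S + K₀ * (M * 2 ^ lam)) * tt m ^ lam) :=
        (abs_add_le _ _).trans (add_le_add ((abs_add_le _ _).trans (add_le_add h1 h4)) h3)
    _ ≤ K₂ * (K₁ * ((S + M) * tt m ^ lam))
        + K₃ * (K₀ * (1 + 2 ^ lam) * (S + M) * tt m ^ lam) * 6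
        + K₄ * (((S + M) + K₀ * ((S + M) * 2 ^ lam)) * tt m ^ lam) := by
        have hMS : M ≤ S + M := by linarith
        have hSS : S ≤ S + M := by linarith
        gcongr
    _ = _ := by ring

lemma tt_rpow (m : ℕ) (lam : ℝ) : tt m ^ lam = ((m + 1 : ℕ) : ℝ) ^ (-(lam / 2)) := by
  have h : (0 : ℝ) ≤ (m + 1 : ℕ) := Nat.cast_nonneg _
  rw [tt, Real.sqrt_eq_rpow, ← Real.rpow_mul (by positivity), Real.rpow_neg h,
    ← Real.inv_rpow h]
  push_cast
  ring_nf

end GenBernstein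

/-- error estimate in Zygmund spaces for generalized Bernstein polynomials. -/
theorem genBernstein_error_zygmund (l : ℕ) (hl : 1 ≤ l) (lam : ℝ) (hlam : 0 < lam)
    (hlam2 : lam ≤ 2 * (l : ℝ)) :
    ∃ C > 0, ∀ f : ℝ → ℝ, memZ lam (2 * l) f → ∀ m : ℕ, 1 ≤ m →
      supNorm (fun x => f x - GBop m l f x) ≤
        C * (m : ℝ) ^ (-(lam / 2)) * Znorm lam (2 * l) f := by
  obtain ⟨n, rfl⟩ : ∃ n, l = n + 1 := ⟨l - 1, by omega⟩
  obtain ⟨K, hK, hb⟩ := GenBernstein.exists_abs_one_sub_bopLin_pow_le n hlam hlam2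
  refine ⟨K + 1, by positivity, fun f hf m hm => ?_⟩
  obtain ⟨k, rfl⟩ : ∃ k, m = k + 1 := ⟨m - 1, by omega⟩
  have : Nonempty (Icc (0 : ℝ) 1) := ⟨⟨0, by simp⟩⟩
  refine ciSup_le fun x => ?_
  have h := hb f hf k x x.2
  rw [GenBernstein.tt_rpow] at h
  have e : f x - GBop (k + 1) (n + 1) f x = ((1 - GenBernstein.bopLin (k + 1)) ^ (n + 1)) f x := by
    rw [GBop, GenBernstein.iterate_sub_Bop_eq, sub_sub_cancel]
  beta_reduce
  rw [e]
  have hZ : 0 ≤ Znorm lam (2 * (n + 1)) f :=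
    add_nonneg ((abs_nonneg _).trans (GenBernstein.abs_le_supNorm hf.1 x.2))
      (GenBernstein.sSup_zygSet_nonneg _ _ _)
  have hr : 0 ≤ ((k + 1 : ℕ) : ℝ) ^ (-(lam / 2)) := by positivity
  nlinarith [mul_nonneg hZ hr]
end

section
/- Let m ≥ 1 and ℓ ≥ 1, let A be the (m+1)×(m+1) matrix with entries A_{i,j} = p_{m,j}(i/m) for i,j = 0,…,m, and set C_{m,ℓ} = ∑_{i=0}^{ℓ−1} (I − A)^i (where I is the identity matrix). Then for every j = 0,…,m and every x ∈ [0,1], the fundamental generalized Bernstein polynomial satisfies p^{(ℓ)}_{m,j}(x) = ∑_{r=0}^m p_{m,r}(x) · (C_{m,ℓ})_{r,j}. -/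
open Set MeasureTheory

/-- Iterates of the Bernstein operator on the Bernstein basis are given by powers of the
collocation matrix of that basis at the nodes `i / m`. -/
theorem Bop_iterate_bern {m : ℕ} {A : Matrix (Fin (m + 1)) (Fin (m + 1)) ℝ}
    (hA : ∀ i j : Fin (m + 1), A i j = bern m (j : ℕ) (((i : ℕ) : ℝ) / (m : ℝ)))
    (n : ℕ) (j : Fin (m + 1)) (x : ℝ) :
    (Bop m)^[n] (bern m j) x = ∑ r : Fin (m + 1), bern m r x * (A ^ n) r j := by
  induction n generalizing x with
  | zero => simp [Matrix.one_apply]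
  | succ n ih =>
    rw [Function.iterate_succ_apply', Bop, Finset.sum_range]
    refine Finset.sum_congr rfl fun r _ => ?_
    rw [ih, pow_succ', Matrix.mul_apply]
    simp only [hA]

/-- Expansion of the geometric sum of `1 - a` in powers of `a`. -/
theorem geom_sum_one_sub_eq_sum_choose {R : Type*} [Ring R] [Algebra ℝ R] (a : R) (l : ℕ) :
    ∑ i ∈ Finset.range l, (1 - a) ^ i =
      ∑ i ∈ Finset.range l, ((l.choose (i + 1) : ℝ) * (-1) ^ i) • a ^ i := by
  have h := congrArg (Polynomial.aeval (-a))
    (Polynomial.geom_sum_X_comp_X_add_one_eq_sum (R := ℝ) l)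
  simp only [Polynomial.aeval_comp, map_sum, map_pow, map_mul, map_add, map_one, map_natCast,
    Polynomial.aeval_X, neg_add_eq_sub] at h
  rw [h]
  refine Finset.sum_congr rfl fun i _ => ?_
  rw [Algebra.smul_def, neg_pow a]
  simp [mul_assoc]

/-- matrix representation of the fundamental generalized Bernstein
polynomials. -/
theorem gbBasis_matrix_representation (m l : ℕ) (hm : 1 ≤ m) (hl : 1 ≤ l)
    (A C : Matrix (Fin (m + 1)) (Fin (m + 1)) ℝ)
    (hA : ∀ i j : Fin (m + 1), A i j = bern m (j : ℕ) (((i : ℕ) : ℝ) / (m : ℝ)))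
    (hC : C = ∑ i ∈ Finset.range l, (1 - A) ^ i) :
    ∀ j : Fin (m + 1), ∀ x ∈ Set.Icc (0 : ℝ) 1,
      gbBasis m l (j : ℕ) x = ∑ r : Fin (m + 1), bern m (r : ℕ) x * C r j := by
  intro j x _
  rw [hC, geom_sum_one_sub_eq_sum_choose, gbBasis,
    ← Finset.Ico_add_one_right_eq_Icc, Finset.sum_Ico_eq_sum_range, Nat.add_sub_cancel]
  simp only [Nat.add_comm 1, Nat.add_sub_cancel, Bop_iterate_bern hA, Matrix.sum_apply,
    Matrix.smul_apply, smul_eq_mul, Finset.mul_sum]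
  rw [Finset.sum_comm]
  refine Finset.sum_congr rfl fun r _ => Finset.sum_congr rfl fun i _ => ?_
  ring
end

section
/- Let λ > 0 and fix an integer r > λ, and define the Zygmund space Z_λ using the Ditzian–Totik modulus of order r. Then Z_λ is closed under pointwise multiplication: if f, g ∈ Z_λ then the product f·g ∈ Z_λ, and there exists a constant C = C(λ, r), independent of f and g, such that ‖f·g‖_{Z_λ} ≤ C · ‖f‖_{Z_λ} · ‖g‖_{Z_λ}. -/
open Set MeasureTheory

open fwdDiff in
/-- A lower bound for the `k`-th differences with step `1` passes to those with step `M`. -/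
lemma pow_mul_le_fwdDiff_iter (M k : ℕ) : ∀ (u : ℕ → ℝ) (j : ℕ) (a : ℝ),
    (∀ i, j ≤ i → i ≤ j + k * M → a ≤ (Δ_[1] ^[k] u) i) →
    (M : ℝ) ^ k * a ≤ (Δ_[M] ^[k] u) j := by
  induction k with
  | zero => intro u j a h; simpa using h j le_rfl (by simp)
  | succ k ih =>
    intro u j a h
    rw [Function.iterate_succ_apply, pow_succ, mul_assoc]
    refine ih _ j _ fun i hi hi' => ?_
    have hcomm : Function.Commute (fwdDiff (G := ℝ) (1 : ℕ)) (fwdDiff M) := fun v => by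
      funext n
      simp only [fwdDiff, add_right_comm n 1 M]
      ring
    have hshift : (Δ_[1] ^[k] (Δ_[M] u)) i = ∑ l ∈ Finset.range M, (Δ_[1] ^[k + 1] u) (i + l) := by
      rw [(hcomm.iterate_left k) u, fwdDiff]
      simp only [Function.iterate_succ_apply', fwdDiff, add_assoc]
      rw [Finset.sum_range_sub (fun l => (Δ_[1] ^[k] u) (i + l))]
      simp
    rw [hshift]
    calc (M : ℝ) * a = ∑ _l ∈ Finset.range M, a := by simp
      _ ≤ _ := Finset.sum_le_sum fun l hl => by
        have := Finset.mem_range.1 hl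
        refine h _ (by omega) ?_
        rw [add_mul]
        omega

open fwdDiff in
lemma abs_fwdDiff_iter_le {S : ℝ} {M : ℕ} {k : ℕ} : ∀ {u : ℕ → ℝ} {j : ℕ},
    (∀ i ≤ j + k * M, |u i| ≤ S) → |(Δ_[M] ^[k] u) j| ≤ 2 ^ k * S := by
  induction k with
  | zero => intro u j h; simpa using h j (by simp)
  | succ k ih =>
    intro u j h
    rw [Function.iterate_succ_apply', fwdDiff, pow_succ]
    have h₁ := ih (u := u) (j := j + M) fun i hi => h i (by rw [add_mul]; omega)
    have h₂ := ih (u := u) (j := j) fun i hi => h i (by rw [add_mul]; omega)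
    linarith [abs_sub ((Δ_[M] ^[k] u) (j + M)) ((Δ_[M] ^[k] u) j)]

open fwdDiff in
/-- One step of the discrete Landau inequality, one-sided form. -/
lemma fwdDiff_iter_le_of_succ {u : ℕ → ℝ} {S F : ℝ} {M k j : ℕ} (hM : 0 < M) (hF : 0 ≤ F)
    (hu : ∀ i ≤ j + k * M, |u i| ≤ S)
    (hd : ∀ i, j ≤ i → i ≤ j + k * M → |(Δ_[1] ^[k + 1] u) i| ≤ F) :
    (Δ_[1] ^[k] u) j ≤ 2 ^ k * S / (M : ℝ) ^ k + k * M * F := by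
  have hdrift : ∀ l ≤ k * M, (Δ_[1] ^[k] u) j - l * F ≤ (Δ_[1] ^[k] u) (j + l) := by
    intro l
    induction l with
    | zero => simp
    | succ l ih =>
      intro hl
      have h₁ := ih (by omega)
      have h₂ := neg_le_of_abs_le (hd (j + l) (by omega) (by omega))
      rw [Function.iterate_succ_apply', fwdDiff, add_assoc] at h₂
      push_cast
      linarith
  have hlow := pow_mul_le_fwdDiff_iter M k u j ((Δ_[1] ^[k] u) j - k * M * F) fun i hi hi' => by
    obtain ⟨l, rfl⟩ := Nat.exists_eq_add_of_le hi
    refine le_trans ?_ (hdrift l (by omega))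
    have : (l : ℝ) ≤ k * M := by exact_mod_cast (by omega : l ≤ k * M)
    gcongr
  have hup := (le_abs_self _).trans (abs_fwdDiff_iter_le hu)
  have hpos : (0 : ℝ) < (M : ℝ) ^ k := by positivity
  rw [← sub_le_iff_le_add, le_div_iff₀ hpos]
  linarith

open fwdDiff in
lemma fwdDiff_iter_neg (k : ℕ) (u : ℕ → ℝ) (j : ℕ) :
    (Δ_[1] ^[k] (-u)) j = -(Δ_[1] ^[k] u) j := by
  simpa using congrFun (fwdDiff_iter_const_smul (h := (1 : ℕ)) (-1 : ℝ) u k) j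

open fwdDiff in
/-- Discrete Landau inequality: a bound for a sequence and for its `r`-th difference on a long
window controls the intermediate differences near the start of the window. -/
lemma exists_abs_fwdDiff_iter_le (r : ℕ) (c : ℝ) (hc : 0 ≤ c) :
    ∃ K : ℝ, 0 ≤ K ∧ ∀ (u : ℕ → ℝ) (S q : ℝ) (M : ℕ), 0 ≤ S → 0 ≤ q → 0 < M →
      q * M ≤ 1 → 1 ≤ 2 * q * M →
      (∀ i ≤ r + r * r * M, |u i| ≤ S) →
      (∀ i ≤ r + r * r * M, |(Δ_[1] ^[r] u) i| ≤ c * S * q ^ r) →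
      ∀ k ≤ r, ∀ j ≤ r, |(Δ_[1] ^[k] u) j| ≤ K * S * q ^ k := by
  -- descending induction on the order `k = r - n`
  have key : ∀ n ≤ r, ∃ K : ℝ, 0 ≤ K ∧ ∀ (u : ℕ → ℝ) (S q : ℝ) (M : ℕ), 0 ≤ S → 0 ≤ q → 0 < M →
      q * M ≤ 1 → 1 ≤ 2 * q * M →
      (∀ i ≤ r + r * r * M, |u i| ≤ S) →
      (∀ i ≤ r + r * r * M, |(Δ_[1] ^[r] u) i| ≤ c * S * q ^ r) →
      ∀ k, k + n = r → ∀ j ≤ r + r * k * M, |(Δ_[1] ^[k] u) j| ≤ K * S * q ^ k := by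
    intro n
    induction n with
    | zero =>
      refine fun _ => ⟨c, hc, fun u S q M _ _ _ _ _ _ hd k hk => ?_⟩
      obtain rfl : k = r := by omega
      exact hd
    | succ n ih =>
      intro hn
      obtain ⟨K, hK, H⟩ := ih (by omega)
      refine ⟨4 ^ r + r * K, by positivity, fun u S q M hS hq hM hqM hMq hu hd k hk j hj => ?_⟩
      have hkr : k ≤ r := by omega
      have hnext := H u S q M hS hq hM hqM hMq hu hd (k + 1) (by omega)
      have hwin : ∀ i ≤ j + k * M, i ≤ r + r * (k + 1) * M := fun i hi => by
        have : k * M ≤ r * M := Nat.mul_le_mul_right _ hkr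
        nlinarith
      have hwin' : ∀ i ≤ j + k * M, i ≤ r + r * r * M := fun i hi => by
        have := hwin i hi
        have : r * (k + 1) * M ≤ r * r * M :=
          Nat.mul_le_mul_right _ (Nat.mul_le_mul_left _ (by omega))
        omega
      have hF : 0 ≤ K * S * q ^ (k + 1) := by positivity
      have hbound : 2 ^ k * S / (M : ℝ) ^ k + k * M * (K * S * q ^ (k + 1))
          ≤ (4 ^ r + r * K) * S * q ^ k := by
        have hMpos : (0 : ℝ) < M := by exact_mod_cast hM
        have h₁ : 2 ^ k * S / (M : ℝ) ^ k ≤ 4 ^ r * S * q ^ k := by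
          rw [div_le_iff₀ (by positivity)]
          have hone : 1 ≤ (2 * q * M) ^ k := one_le_pow₀ hMq
          have h4 : (4 : ℝ) ^ k ≤ 4 ^ r := pow_le_pow_right₀ (by norm_num) hkr
          calc 2 ^ k * S = 2 ^ k * S * 1 := by ring
            _ ≤ 2 ^ k * S * (2 * q * M) ^ k := by gcongr
            _ = (2 * 2) ^ k * S * q ^ k * M ^ k := by simp only [mul_pow]; ring
            _ ≤ 4 ^ r * S * q ^ k * M ^ k := by norm_num; gcongr
        have h₂ : k * M * (K * S * q ^ (k + 1)) ≤ r * K * S * q ^ k := by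
          have hkr' : (k : ℝ) ≤ r := by exact_mod_cast hkr
          calc k * M * (K * S * q ^ (k + 1)) = k * K * S * q ^ k * (q * M) := by ring
            _ ≤ r * K * S * q ^ k * 1 := by gcongr
            _ = _ := by ring
        linarith
      refine abs_le'.2 ⟨?_, ?_⟩
      · exact (fwdDiff_iter_le_of_succ hM hF (fun i hi => hu i (hwin' i hi))
          fun i _ hi => hnext i (hwin i hi)).trans hbound
      · rw [← fwdDiff_iter_neg]
        refine (fwdDiff_iter_le_of_succ hM hF (fun i hi => ?_) fun i _ hi => ?_).trans hbound
        · rw [Pi.neg_apply, abs_neg]; exact hu i (hwin' i hi)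
        · rw [fwdDiff_iter_neg, abs_neg]; exact hnext i (hwin i hi)
  choose! K hK H using key
  refine ⟨∑ n ∈ Finset.range (r + 1), K n, Finset.sum_nonneg fun n hn => hK n ?_,
    fun u S q M hS hq hM hqM hMq hu hd k hk j hj => ?_⟩
  · have := Finset.mem_range.1 hn
    omega
  · have hle : K (r - k) ≤ ∑ n ∈ Finset.range (r + 1), K n := by
      refine Finset.single_le_sum (f := K) (fun n hn => hK n ?_) (Finset.mem_range.2 (by omega))
      have := Finset.mem_range.1 hn
      omega
    refine (H (r - k) (by omega) u S q M hS hq hM hqM hMq hu hd k (by omega) j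
      (hj.trans (Nat.le_add_right _ _))).trans ?_
    gcongr

open fwdDiff in
/-- Leibniz-type estimate for the differences of a product. -/
lemma abs_fwdDiff_iter_mul_le {q : ℝ} (n : ℕ) : ∀ {u w : ℕ → ℝ} {U W : ℝ},
    (∀ k j, k + j ≤ n → |(Δ_[1] ^[k] u) j| ≤ U * q ^ k) →
    (∀ k j, k + j ≤ n → |(Δ_[1] ^[k] w) j| ≤ W * q ^ k) →
    |(Δ_[1] ^[n] (fun i => u i * w i)) 0| ≤ 2 ^ n * U * W * q ^ n := by
  induction n with
  | zero =>
    intro u w U W hu hw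
    have h₁ := hu 0 0 le_rfl
    have h₂ := hw 0 0 le_rfl
    simp only [Function.iterate_zero, id, pow_zero, mul_one, one_mul] at h₁ h₂ ⊢
    rw [abs_mul]
    exact mul_le_mul h₁ h₂ (abs_nonneg _) ((abs_nonneg _).trans h₁)
  | succ n ih =>
    intro u w U W hu hw
    have hprod : Δ_[1] (fun i => u i * w i) =
        (fun i => (Δ_[1] u) i * w i) + fun i => u (i + 1) * (Δ_[1] w) i := by
      funext i
      simp only [fwdDiff, Pi.add_apply]
      ring
    rw [Function.iterate_succ_apply, hprod, fwdDiff_iter_add, Pi.add_apply]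
    have h₁ := ih (u := Δ_[1] u) (w := w) (U := U * q) (W := W)
      (fun k j hk => by
        rw [← Function.iterate_succ_apply]
        exact (hu (k + 1) j (by omega)).trans_eq (by ring))
      fun k j hk => hw k j (by omega)
    have h₂ := ih (u := fun i => u (i + 1)) (w := Δ_[1] w) (U := U) (W := W * q)
      (fun k j hk => by rw [fwdDiff_iter_comp_add]; exact hu k (j + 1) (by omega))
      (fun k j hk => by
        rw [← Function.iterate_succ_apply]
        exact (hw (k + 1) j (by omega)).trans_eq (by ring))
    calc _ ≤ _ := abs_add_le _ _
      _ ≤ _ := add_le_add h₁ h₂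
      _ = _ := by ring

/-- `S` bounds `|f|` on `[0,1]` and all quotients `|Δ^r_{hφ} f(x)| / h^λ`. -/
def IsZygBound (lam : ℝ) (r : ℕ) (S : ℝ) (f : ℝ → ℝ) : Prop :=
  (∀ x ∈ Set.Icc (0 : ℝ) 1, |f x| ≤ S) ∧
    ∀ h x, 0 < h → dtAdmissible r h x → |dtDiff r h f x| ≤ S * h ^ lam

lemma IsZygBound.nonneg {lam : ℝ} {r : ℕ} {S : ℝ} {f : ℝ → ℝ} (hf : IsZygBound lam r S f) :
    0 ≤ S :=
  (abs_nonneg _).trans (hf.1 0 (by simp))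

lemma phiDT_one_sub (x : ℝ) : phiDT (1 - x) = phiDT x := by
  unfold phiDT
  ring_nf

lemma phiDT_le_half (x : ℝ) : phiDT x ≤ 1 / 2 :=
  Real.sqrt_le_iff.2 ⟨by norm_num, by nlinarith [sq_nonneg (x - 1 / 2)]⟩

lemma phiDT_le_two_mul {x y : ℝ} (hx : 0 ≤ x) (hxy : x ≤ y) (hy : y ≤ 3 / 4) :
    phiDT x ≤ 2 * phiDT y := by
  have h : (2 : ℝ) * phiDT y = √(4 * (y * (1 - y))) := by
    rw [Real.sqrt_mul (by norm_num), show (4 : ℝ) = 2 ^ 2 by norm_num,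
      Real.sqrt_sq (by norm_num), phiDT]
  rw [h]
  exact Real.sqrt_le_sqrt (by nlinarith)

lemma dtDiff_eq_sum_reflect (r : ℕ) (h : ℝ) (f : ℝ → ℝ) (x : ℝ) :
    dtDiff r h f x = ∑ k ∈ Finset.range (r + 1), (-1 : ℝ) ^ (r - k) * (r.choose k : ℝ) *
      f (x - ((r : ℝ) - 2 * k) * (h / 2) * phiDT x) := by
  rw [dtDiff, ← Finset.sum_range_reflect]
  refine Finset.sum_congr rfl fun k hk => ?_
  have hk' : k ≤ r := Nat.lt_succ_iff.1 (Finset.mem_range.1 hk)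
  rw [show r + 1 - 1 - k = r - k by omega, Nat.choose_symm hk', Nat.cast_sub hk']
  ring_nf

open fwdDiff in
/-- The symmetric difference as a forward difference of the values on an arithmetic progression. -/
lemma fwdDiff_iter_eq_dtDiff {r : ℕ} {h d x : ℝ} (f : ℝ → ℝ) (j : ℕ)
    (hd : h * phiDT (x + j * d) = d) :
    (Δ_[1] ^[r] (fun i : ℕ => f (x - r * (d / 2) + i * d))) j = dtDiff r h f (x + j * d) := by
  rw [dtDiff_eq_sum_reflect, fwdDiff_iter_eq_sum_shift]
  refine Finset.sum_congr rfl fun k _ => ?_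
  have harg : x - r * (d / 2) + ((j + k • 1 : ℕ) : ℝ) * d =
      x + j * d - ((r : ℝ) - 2 * k) * (h / 2) * phiDT (x + j * d) := by
    rw [mul_assoc, div_mul_eq_mul_div, hd]
    push_cast
    simp only [smul_eq_mul, mul_one]
    ring
  rw [harg]
  simp

lemma abs_dtDiff_le {r : ℕ} {h x S : ℝ} {f : ℝ → ℝ} (hx : dtAdmissible r h x)
    (hf : ∀ x ∈ Set.Icc (0 : ℝ) 1, |f x| ≤ S) : |dtDiff r h f x| ≤ 2 ^ r * S := by
  refine (Finset.abs_sum_le_sum_abs _ _).trans ?_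
  have hsum : (∑ k ∈ Finset.range (r + 1), (r.choose k : ℝ)) = 2 ^ r := by
    exact_mod_cast Nat.sum_range_choose r
  rw [← hsum, Finset.sum_mul]
  refine Finset.sum_le_sum fun k hk => ?_
  rw [abs_mul, abs_mul, abs_pow, abs_neg, abs_one, one_pow, one_mul, Nat.abs_cast]
  gcongr
  exact hf _ (hx.2 k (Nat.lt_succ_iff.1 (Finset.mem_range.1 hk)))

lemma dtAdmissible.one_sub {r : ℕ} {h x : ℝ} (hx : dtAdmissible r h x) :
    dtAdmissible r h (1 - x) := by
  refine ⟨⟨by linarith [hx.1.2], by linarith [hx.1.1]⟩, fun k hk => ?_⟩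
  have := hx.2 (r - k) (Nat.sub_le _ _)
  rw [Nat.cast_sub hk] at this
  rw [phiDT_one_sub]
  constructor <;> linarith [this.1, this.2]

lemma abs_dtDiff_one_sub (r : ℕ) (h : ℝ) (f : ℝ → ℝ) (x : ℝ) :
    |dtDiff r h (fun y => f (1 - y)) x| = |dtDiff r h f (1 - x)| := by
  have : dtDiff r h (fun y => f (1 - y)) x = (-1) ^ r * dtDiff r h f (1 - x) := by
    rw [dtDiff_eq_sum_reflect, dtDiff, Finset.mul_sum]
    refine Finset.sum_congr rfl fun k hk => ?_
    have hk' : k ≤ r := Nat.lt_succ_iff.1 (Finset.mem_range.1 hk)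
    obtain ⟨m, rfl⟩ := Nat.exists_eq_add_of_le hk'
    have hsign : (-1 : ℝ) ^ (k + m) * (-1) ^ k = (-1) ^ m := by
      rw [← pow_add, show k + m + k = 2 * k + m by ring, pow_add, pow_mul]
      simp
    rw [phiDT_one_sub, ← mul_assoc, ← mul_assoc, hsign, Nat.add_sub_cancel_left]
    ring_nf
  rw [this, abs_mul, abs_pow, abs_neg, abs_one, one_pow, one_mul]

lemma IsZygBound.one_sub {lam : ℝ} {r : ℕ} {S : ℝ} {f : ℝ → ℝ} (hf : IsZygBound lam r S f) :
    IsZygBound lam r S (fun y => f (1 - y)) :=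
  ⟨fun x hx => hf.1 _ ⟨by linarith [hx.2], by linarith [hx.1]⟩, fun h x hh hx => by
    rw [abs_dtDiff_one_sub]
    exact hf.2 h _ hh hx.one_sub⟩

open fwdDiff in
/-- Near the left end point the intermediate differences of order `k` are `O(h^{λk/r})`. -/
lemma exists_abs_fwdDiff_iter_node_le (lam : ℝ) (hlam : 0 < lam) (r : ℕ) (hr : lam < r) :
    ∃ K h₀ : ℝ, 0 ≤ K ∧ 0 < h₀ ∧ ∀ (f : ℝ → ℝ) (S h x : ℝ), IsZygBound lam r S f →
      0 < h → h ≤ h₀ → dtAdmissible r h x → x ≤ 1 / 2 → 0 < x → ∀ k ≤ r, ∀ j ≤ r,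
      |(Δ_[1] ^[k] (fun i : ℕ => f (x - r * (h * phiDT x / 2) + i * (h * phiDT x)))) j|
        ≤ K * S * (h ^ (lam / r)) ^ k := by
  have hr0 : (0 : ℝ) < r := hlam.trans hr
  obtain ⟨K, hK, H⟩ := exists_abs_fwdDiff_iter_le r (2 ^ lam) (by positivity)
  have hexp : 0 < 1 - lam / r := by rw [sub_pos, div_lt_one hr0]; exact hr
  have hc : (0 : ℝ) < 1 / (2 * (2 * r + r ^ 2)) := by positivity
  refine ⟨K, min 1 ((1 / (2 * (2 * r + r ^ 2))) ^ (1 - lam / r)⁻¹), hK, by positivity,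
    fun f S h x hf hh hh₀ hx hx2 hx0 => ?_⟩
  have hh1 : h ≤ 1 := hh₀.trans (min_le_left _ _)
  have hsmall : (2 * r + r ^ 2) * h ^ (1 - lam / r) ≤ 1 / 2 := by
    have := Real.rpow_le_rpow hh.le (hh₀.trans (min_le_right _ _)) hexp.le
    rw [← Real.rpow_mul hc.le, inv_mul_cancel₀ hexp.ne', Real.rpow_one,
      le_div_iff₀ (by positivity)] at this
    linarith
  set q := h ^ (lam / r) with hq
  have hqpos : 0 < q := Real.rpow_pos_of_pos hh _
  have hq1 : q ≤ 1 := Real.rpow_le_one hh.le hh1 (by positivity)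
  have hqr : q ^ r = h ^ lam := by
    rw [hq, ← Real.rpow_mul_natCast hh.le, div_mul_cancel₀ _ hr0.ne']
  have hqh : h ^ (1 - lam / r) * q = h := by
    rw [hq, ← Real.rpow_add hh, sub_add_cancel, Real.rpow_one]
  set M := ⌊q⁻¹⌋₊
  have hone : 1 ≤ q⁻¹ := (one_le_inv₀ hqpos).2 hq1
  have hMpos : 0 < M := Nat.floor_pos.2 hone
  have hMle : (M : ℝ) ≤ q⁻¹ := Nat.floor_le (by positivity)
  have hMlt : q⁻¹ < M + 1 := Nat.lt_floor_add_one _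
  have hM1 : (1 : ℝ) ≤ M := by exact_mod_cast hMpos
  have hqM : q * M ≤ 1 := by
    calc q * M ≤ q * q⁻¹ := by gcongr
      _ = 1 := mul_inv_cancel₀ hqpos.ne'
  have hMq : 1 ≤ 2 * q * M := by
    calc 1 = q * q⁻¹ := (mul_inv_cancel₀ hqpos.ne').symm
      _ ≤ q * (2 * M) := by gcongr; linarith
      _ = _ := by ring
  have hφ : 0 < phiDT x := Real.sqrt_pos.2 (mul_pos hx0 (by linarith))
  set d := h * phiDT x with hd
  have hdpos : 0 < d := mul_pos hh hφ
  have hnode : 0 ≤ x - r * (d / 2) := by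
    have := (hx.2 r le_rfl).1
    rw [mul_assoc, div_mul_eq_mul_div] at this
    linarith
  -- the window of `(2r + r²) M` steps stays inside `[0, 3/4]`
  have hlen : (2 * r + r ^ 2) * M * d ≤ 1 / 4 := by
    have h₁ : M * h ≤ h ^ (1 - lam / r) := by
      calc M * h = h ^ (1 - lam / r) * (q * M) := by linear_combination -(M : ℝ) * hqh
        _ ≤ h ^ (1 - lam / r) * 1 := by gcongr
        _ = _ := mul_one _
    calc (2 * r + r ^ 2) * M * d = (2 * r + r ^ 2) * (M * h) * phiDT x := by rw [hd]; ring
      _ ≤ (2 * r + r ^ 2) * h ^ (1 - lam / r) * (1 / 2) := by gcongr; exact phiDT_le_half x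
      _ ≤ 1 / 4 := by linarith
  have hwin : ∀ i : ℕ, i ≤ 2 * r + r * r * M → x + i * d ≤ 3 / 4 := fun i hi => by
    have h₁ : (i : ℝ) ≤ 2 * r + r * r * M := by exact_mod_cast hi
    have h₂ : (i : ℝ) ≤ (2 * r + r ^ 2) * M := by nlinarith
    nlinarith
  have hmem : ∀ i : ℕ, i ≤ 2 * r + r * r * M →
      x - r * (d / 2) + i * d ∈ Set.Icc (0 : ℝ) 1 := fun i hi => by
    have := hwin i hi
    have : 0 ≤ i * d := by positivity
    have : 0 ≤ r * (d / 2) := by positivity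
    constructor <;> linarith
  refine H _ S q M hf.nonneg hqpos.le hMpos hqM hMq (fun i hi => hf.1 _ (hmem i (by omega)))
    fun i hi => ?_
  have hi' := hwin i (by omega)
  have hle : x ≤ x + i * d := le_add_of_nonneg_right (by positivity)
  have hφi : 0 < phiDT (x + i * d) := Real.sqrt_pos.2 (mul_pos (by linarith) (by linarith))
  have hstep : d / phiDT (x + i * d) * phiDT (x + i * d) = d := div_mul_cancel₀ _ hφi.ne'
  have hstep_le : d / phiDT (x + i * d) ≤ 2 * h := by
    rw [div_le_iff₀ hφi, hd]
    nlinarith [phiDT_le_two_mul hx0.le hle hi']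
  have hadm : dtAdmissible r (d / phiDT (x + i * d)) (x + i * d) := by
    refine ⟨⟨by linarith, by linarith⟩, fun k hk => ?_⟩
    have := hmem (i + (r - k)) (by omega)
    rw [Nat.cast_add, Nat.cast_sub hk] at this
    rw [mul_assoc, div_mul_eq_mul_div, hstep]
    convert this using 1
    ring
  rw [fwdDiff_iter_eq_dtDiff f i hstep]
  calc _ ≤ _ := hf.2 _ _ (by positivity) hadm
    _ ≤ S * (2 * h) ^ lam := by
      have := hf.nonneg
      gcongr
    _ = 2 ^ lam * S * q ^ r := by rw [Real.mul_rpow (by norm_num) hh.le, hqr]; ring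

lemma dtDiff_zero {r : ℕ} (hr : r ≠ 0) (h : ℝ) (f : ℝ → ℝ) : dtDiff r h f 0 = 0 := by
  have hsum : (∑ k ∈ Finset.range (r + 1), (-1 : ℝ) ^ k * (r.choose k : ℝ)) = 0 := by
    exact_mod_cast Int.alternating_sum_range_choose_of_ne hr
  simp [dtDiff, phiDT, ← Finset.sum_mul, hsum]

lemma exists_abs_dtDiff_mul_le_of_le_half (lam : ℝ) (hlam : 0 < lam) (r : ℕ) (hr : lam < r) :
    ∃ K : ℝ, 0 ≤ K ∧ ∀ (f g : ℝ → ℝ) (S T h x : ℝ), IsZygBound lam r S f →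
      IsZygBound lam r T g → 0 < h → dtAdmissible r h x → x ≤ 1 / 2 →
      |dtDiff r h (fun y => f y * g y) x| ≤ K * S * T * h ^ lam := by
  have hr0 : (0 : ℝ) < r := hlam.trans hr
  obtain ⟨K, h₀, hK, hh₀, H⟩ := exists_abs_fwdDiff_iter_node_le lam hlam r hr
  refine ⟨2 ^ r * K * K + 2 ^ r / h₀ ^ lam, by positivity,
    fun f g S T h x hf hg hh hx hx2 => ?_⟩
  have hS := hf.nonneg
  have hT := hg.nonneg
  have hsplit : ∀ {a : ℝ}, a ≤ 2 ^ r * K * K * S * T * h ^ lam ∨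
      a ≤ 2 ^ r / h₀ ^ lam * S * T * h ^ lam →
      a ≤ (2 ^ r * K * K + 2 ^ r / h₀ ^ lam) * S * T * h ^ lam := by
    intro a ha
    have h₁ : 0 ≤ 2 ^ r * K * K * S * T * h ^ lam := by positivity
    have h₂ : 0 ≤ 2 ^ r / h₀ ^ lam * S * T * h ^ lam := by positivity
    rcases ha with ha | ha <;> linarith
  apply hsplit
  rcases le_or_gt h h₀ with hle | hlt
  · left
    rcases hx.1.1.eq_or_lt with rfl | hx0
    · rw [dtDiff_zero (by exact_mod_cast hr0.ne'), abs_zero]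
      positivity
    · have hprod := abs_fwdDiff_iter_mul_le r
        (fun k j hkj => H f S h x hf hh hle hx hx2 hx0 k (by omega) j (by omega))
        (fun k j hkj => H g T h x hg hh hle hx hx2 hx0 k (by omega) j (by omega))
      have heq := fwdDiff_iter_eq_dtDiff (r := r) (h := h) (d := h * phiDT x) (x := x)
        (fun y => f y * g y) 0 (by simp)
      rw [Nat.cast_zero, zero_mul, add_zero] at heq
      rw [heq, ← Real.rpow_mul_natCast hh.le, div_mul_cancel₀ _ hr0.ne'] at hprod
      exact hprod.trans_eq (by ring)
  · right
    have hone : 1 ≤ h ^ lam / h₀ ^ lam :=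
      (one_le_div (by positivity)).2 (Real.rpow_le_rpow hh₀.le hlt.le hlam.le)
    calc _ ≤ 2 ^ r * (S * T) := abs_dtDiff_le hx fun y hy => by
          rw [abs_mul]
          exact mul_le_mul (hf.1 y hy) (hg.1 y hy) (abs_nonneg _) hS
      _ = 2 ^ r * (S * T) * 1 := by ring
      _ ≤ 2 ^ r * (S * T) * (h ^ lam / h₀ ^ lam) := by gcongr
      _ = _ := by ring

lemma exists_abs_dtDiff_mul_le (lam : ℝ) (hlam : 0 < lam) (r : ℕ) (hr : lam < r) :
    ∃ K : ℝ, 0 ≤ K ∧ ∀ (f g : ℝ → ℝ) (S T h x : ℝ), IsZygBound lam r S f →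
      IsZygBound lam r T g → 0 < h → dtAdmissible r h x →
      |dtDiff r h (fun y => f y * g y) x| ≤ K * S * T * h ^ lam := by
  obtain ⟨K, hK, H⟩ := exists_abs_dtDiff_mul_le_of_le_half lam hlam r hr
  refine ⟨K, hK, fun f g S T h x hf hg hh hx => ?_⟩
  rcases le_total x (1 / 2) with hx2 | hx2
  · exact H f g S T h x hf hg hh hx hx2
  · have := H _ _ S T h (1 - x) hf.one_sub hg.one_sub hh hx.one_sub (by linarith)
    rwa [abs_dtDiff_one_sub r h (fun y => f y * g y), sub_sub_cancel] at this

lemma supNorm_nonneg (f : ℝ → ℝ) : 0 ≤ supNorm f := Real.iSup_nonneg fun _ => abs_nonneg _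

lemma abs_le_supNorm {f : ℝ → ℝ} (hf : ContinuousOn f (Set.Icc 0 1)) {x : ℝ}
    (hx : x ∈ Set.Icc (0 : ℝ) 1) : |f x| ≤ supNorm f := by
  obtain ⟨C, hC⟩ := isCompact_Icc.exists_bound_of_continuousOn hf
  refine le_ciSup (f := fun y : Set.Icc (0 : ℝ) 1 => |f y|) ⟨C, ?_⟩ ⟨x, hx⟩
  rintro _ ⟨y, rfl⟩
  exact hC y y.2

lemma sSup_zygSet_nonneg (lam : ℝ) (r : ℕ) (f : ℝ → ℝ) : 0 ≤ sSup (zygSet lam r f) := by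
  refine Real.sSup_nonneg ?_
  rintro _ ⟨t, ht, rfl⟩
  refine div_nonneg (Real.sSup_nonneg ?_) (Real.rpow_nonneg ht.le _)
  rintro _ ⟨h, x, -, -, -, rfl⟩
  exact abs_nonneg _

lemma memZ.isZygBound {lam : ℝ} {r : ℕ} {f : ℝ → ℝ} (hf : memZ lam r f) :
    IsZygBound lam r (Znorm lam r f) f := by
  refine ⟨fun x hx => (abs_le_supNorm hf.1 hx).trans
    (le_add_of_nonneg_right (sSup_zygSet_nonneg _ _ _)), fun h x hh hx => ?_⟩
  have hpos : 0 < h ^ lam := Real.rpow_pos_of_pos hh _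
  have h₁ : |dtDiff r h f x| ≤ omegaDT r f h := by
    refine le_csSup ⟨2 ^ r * supNorm f, ?_⟩ ⟨h, x, hh, le_rfl, hx, rfl⟩
    rintro _ ⟨h', x', -, -, hx', rfl⟩
    exact abs_dtDiff_le hx' fun y hy => abs_le_supNorm hf.1 hy
  have h₂ : omegaDT r f h / h ^ lam ≤ sSup (zygSet lam r f) := le_csSup hf.2 ⟨h, hh, rfl⟩
  rw [div_le_iff₀ hpos] at h₂
  refine h₁.trans (h₂.trans ?_)
  gcongr
  exact le_add_of_nonneg_left (supNorm_nonneg f)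

lemma zygSet_le_of_abs_dtDiff_le {lam : ℝ} (hlam : 0 < lam) {r : ℕ} {f : ℝ → ℝ} {A : ℝ}
    (hA : 0 ≤ A)
    (hf : ∀ h x, 0 < h → dtAdmissible r h x → |dtDiff r h f x| ≤ A * h ^ lam) :
    ∀ y ∈ zygSet lam r f, y ≤ A := by
  rintro _ ⟨t, ht, rfl⟩
  rw [div_le_iff₀ (Real.rpow_pos_of_pos ht _)]
  refine Real.sSup_le ?_ (by positivity)
  rintro _ ⟨h, x, hh, hht, hx, rfl⟩
  refine (hf h x hh hx).trans ?_
  gcongr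

/-- the Zygmund space `Z_λ` is a Banach algebra under pointwise
multiplication. -/
theorem zygmund_mul (lam : ℝ) (hlam : 0 < lam) (r : ℕ) (hr : lam < (r : ℝ)) :
    ∃ C > 0, ∀ f g : ℝ → ℝ, memZ lam r f → memZ lam r g →
      memZ lam r (fun x => f x * g x) ∧
        Znorm lam r (fun x => f x * g x) ≤ C * Znorm lam r f * Znorm lam r g := by

  obtain ⟨K, hK, H⟩ := exists_abs_dtDiff_mul_le lam hlam r hr
  refine ⟨K + 1, by positivity, fun f g hf hg => ?_⟩
  have hF := hf.isZygBound
  have hG := hg.isZygBound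
  have hS := hF.nonneg
  have hT := hG.nonneg
  have hbound := zygSet_le_of_abs_dtDiff_le hlam (f := fun x => f x * g x)
    (A := K * Znorm lam r f * Znorm lam r g) (by positivity)
    fun h x hh hx => H f g _ _ h x hF hG hh hx
  refine ⟨⟨hf.1.mul hg.1, _, hbound⟩, ?_⟩
  have hsup : supNorm (fun x => f x * g x) ≤ Znorm lam r f * Znorm lam r g := by
    refine Real.iSup_le (fun x => ?_) (by positivity)
    rw [abs_mul]
    exact mul_le_mul (hF.1 x x.2) (hG.1 x x.2) (abs_nonneg _) hS
  have hzyg := Real.sSup_le hbound (by positivity)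
  calc Znorm lam r (fun x => f x * g x)
      ≤ Znorm lam r f * Znorm lam r g + K * Znorm lam r f * Znorm lam r g :=
        add_le_add hsup hzyg
    _ = _ := by ring
end

section
/- Fix m ≥ 1 and f ∈ C([0,1]), and let L_m(f) be the unique polynomial of degree at most m satisfying L_m(f)(j/m) = f(j/m) for j = 0, …, m (Lagrange interpolation at the equispaced nodes j/m). Then the generalized Bernstein polynomials converge uniformly to the Lagrange interpolant as the iteration parameter tends to infinity: lim_{ℓ→∞} sup_{x∈[0,1]} |B_{m,ℓ}(f, x) − L_m(f)(x)| = 0. -/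
open Set MeasureTheory

/-- If `T v = μ • v + w` with `0 ≤ μ < 1` and the orbit of `w` under `T` is absolutely summable
for a seminorm, then so is the orbit of `v`. -/
lemma summable_seminorm_iterate_of_eq_smul_add {V : Type*} [AddCommGroup V] [Module ℝ V]
    (N : Seminorm ℝ V) (T : V →ₗ[ℝ] V) {μ : ℝ} (hμ₀ : 0 ≤ μ) (hμ₁ : μ < 1) {v w : V}
    (hv : T v = μ • v + w) (hw : Summable fun l : ℕ => N ((T ^ l) w)) :
    Summable fun l : ℕ => N ((T ^ l) v) := by
  have hstep : ∀ l : ℕ, N ((T ^ (l + 1)) v) ≤ μ * N ((T ^ l) v) + N ((T ^ l) w) := by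
    intro l
    rw [pow_succ, Module.End.mul_apply, hv, map_add, map_smul]
    refine (map_add_le_add N _ _).trans_eq ?_
    rw [map_smul_eq_mul, Real.norm_of_nonneg hμ₀]
  refine summable_of_sum_range_le
    (c := (N v + ∑' l, N ((T ^ l) w)) / (1 - μ)) (fun l => apply_nonneg N _) fun n => ?_
  rw [le_div_iff₀ (by linarith)]
  have hsum : ∑ l ∈ Finset.range n, N ((T ^ (l + 1)) v) ≤
      μ * ∑ l ∈ Finset.range n, N ((T ^ l) v) + ∑' l, N ((T ^ l) w) := by
    refine (Finset.sum_le_sum fun l _ => hstep l).trans ?_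
    rw [Finset.sum_add_distrib, Finset.mul_sum]
    gcongr
    exact hw.sum_le_tsum _ fun l _ => apply_nonneg N _
  have hshift := Finset.sum_range_succ' (fun l => N ((T ^ l) v)) n
  rw [Finset.sum_range_succ, pow_zero, Module.End.one_apply] at hshift
  have hlast : 0 ≤ N ((T ^ n) v) := apply_nonneg N _
  linarith

/-- The vectors whose orbit under `T` is absolutely summable for the seminorm `N`. -/
def summableOrbits {V : Type*} [AddCommGroup V] [Module ℝ V]
    (N : Seminorm ℝ V) (T : V →ₗ[ℝ] V) : Submodule ℝ V where
  carrier := {v | Summable fun l : ℕ => N ((T ^ l) v)}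
  zero_mem' := by simp [summable_zero]
  add_mem' {v w} hv hw := by
    refine Summable.of_nonneg_of_le (fun l => apply_nonneg N _) (fun l => ?_) (hv.add hw)
    rw [map_add]
    exact map_add_le_add N _ _
  smul_mem' c v hv := by
    simpa [map_smul_eq_mul] using hv.mul_left |c|

namespace Polynomial

/-- The Bernstein operator on polynomials. -/
noncomputable def bernsteinOp (m : ℕ) : ℝ[X] →ₗ[ℝ] ℝ[X] :=
  ∑ k ∈ Finset.range (m + 1),
    (leval ((k : ℝ) / (m : ℝ))).smulRight (bernsteinPolynomial ℝ m k)

lemma bernsteinOp_apply (m : ℕ) (p : ℝ[X]) :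
    bernsteinOp m p =
      ∑ k ∈ Finset.range (m + 1), p.eval ((k : ℝ) / (m : ℝ)) • bernsteinPolynomial ℝ m k := by
  simp [bernsteinOp, LinearMap.sum_apply]

lemma eval_bernsteinOp (m : ℕ) (p : ℝ[X]) (x : ℝ) :
    (bernsteinOp m p).eval x = Bop m (fun y => p.eval y) x := by
  simp [bernsteinOp_apply, Bop, bern, bernsteinPolynomial, eval_finsetSum, mul_comm]

/-- Factorial moments of the Bernstein basis. -/
lemma sum_descFactorial_smul_bernsteinPolynomial {m d : ℕ} (hd : d ≤ m) :
    ∑ k ∈ Finset.range (m + 1), (k.descFactorial d : ℝ) • bernsteinPolynomial ℝ m k =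
      (m.descFactorial d : ℝ) • X ^ d := by
  obtain ⟨n, rfl⟩ := Nat.exists_eq_add_of_le hd
  rw [add_assoc, Finset.sum_range_add, Finset.sum_eq_zero, zero_add]
  · have hterm : ∀ j ∈ Finset.range (n + 1),
        ((d + j).descFactorial d : ℝ) • bernsteinPolynomial ℝ (d + n) (d + j) =
          ((d + n).descFactorial d : ℝ) • (X ^ d * bernsteinPolynomial ℝ n j) := by
      intro j hj
      have hj : j ≤ n := Nat.lt_succ_iff.mp (Finset.mem_range.mp hj)
      have hnat : (d + j).descFactorial d * (d + n).choose (d + j) =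
          (d + n).descFactorial d * n.choose j := by
        have h := Nat.choose_mul (n := d + n) (k := d + j) (s := d) (by omega)
        simp only [Nat.add_sub_cancel_left] at h
        rw [Nat.descFactorial_eq_factorial_mul_choose, Nat.descFactorial_eq_factorial_mul_choose,
          mul_assoc, mul_assoc, ← h, mul_comm ((d + j).choose d)]
      have hpoly := congrArg (Nat.cast : ℕ → ℝ[X]) hnat
      push_cast at hpoly
      simp only [bernsteinPolynomial, smul_eq_C_mul, map_natCast, Nat.add_sub_add_left]
      rw [pow_add]
      linear_combination (X ^ d * X ^ j * (1 - X) ^ (n - j)) * hpoly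
    rw [Finset.sum_congr rfl hterm, ← Finset.smul_sum, ← Finset.mul_sum, bernsteinPolynomial.sum,
      mul_one]
  · intro k hk
    simp [Nat.descFactorial_of_lt (Finset.mem_range.mp hk)]

/-- The falling factorial of `m * X`. -/
noncomputable def scaledDescPochhammer (m d : ℕ) : ℝ[X] :=
  (descPochhammer ℝ d).comp (C (m : ℝ) * X)

lemma bernsteinOp_scaledDescPochhammer {m d : ℕ} (hm : m ≠ 0) (hd : d ≤ m) :
    bernsteinOp m (scaledDescPochhammer m d) = (m.descFactorial d : ℝ) • X ^ d := by
  rw [bernsteinOp_apply, ← sum_descFactorial_smul_bernsteinPolynomial hd]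
  refine Finset.sum_congr rfl fun k _ => ?_
  have hm' : (m : ℝ) ≠ 0 := Nat.cast_ne_zero.mpr hm
  simp [scaledDescPochhammer, eval_comp, mul_div_cancel₀, hm',
    descPochhammer_eval_eq_descFactorial]

lemma coeff_scaledDescPochhammer_self (m d : ℕ) :
    (scaledDescPochhammer m d).coeff d = (m : ℝ) ^ d := by
  have h : (descPochhammer ℝ d).coeff d = 1 := by
    simpa [Monic, leadingCoeff, descPochhammer_natDegree] using monic_descPochhammer ℝ d
  rw [scaledDescPochhammer, comp_C_mul_X_coeff, h, one_mul]

lemma coeff_scaledDescPochhammer_of_lt {m d n : ℕ} (h : d < n) :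
    (scaledDescPochhammer m d).coeff n = 0 := by
  rw [scaledDescPochhammer, comp_C_mul_X_coeff, coeff_eq_zero_of_natDegree_lt, zero_mul]
  rwa [descPochhammer_natDegree]

lemma mem_degreeLT_of_coeff_eq_zero {p : ℝ[X]} {d : ℕ} (hself : p.coeff d = 0)
    (hlt : ∀ n, d < n → p.coeff n = 0) : p ∈ degreeLT ℝ d := by
  rw [mem_degreeLT, degree_lt_iff_coeff_zero]
  intro n hn
  rcases hn.eq_or_lt with rfl | h
  · exact hself
  · exact hlt n h

/-- For any seminorm, the orbits of `1 - bernsteinOp m` on polynomials of degree at most `m` are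
absolutely summable: on this space the operator is triangular with diagonal entries in `[0, 1)`. -/
lemma degreeLT_le_summableOrbits {m : ℕ} (hm : m ≠ 0) (N : Seminorm ℝ ℝ[X]) {d : ℕ}
    (hd : d ≤ m + 1) : degreeLT ℝ d ≤ summableOrbits N (1 - bernsteinOp m) := by
  induction d with
  | zero =>
    intro p hp
    have : p = 0 := by simpa [mem_degreeLT, degree_eq_bot] using hp
    exact this ▸ zero_mem _
  | succ d ih =>
    have ih := ih (by omega)
    have hdm : d ≤ m := by omega
    set D := scaledDescPochhammer m d with hD
    have hmd : (0 : ℝ) < (m : ℝ) ^ d := by positivity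
    set lam : ℝ := (m.descFactorial d : ℝ) / (m : ℝ) ^ d with hlam
    have hlam_pos : 0 < lam :=
      div_pos (Nat.cast_pos.mpr (Nat.descFactorial_pos.mpr hdm)) hmd
    have hlam_le : lam ≤ 1 :=
      div_le_one_of_le₀ (by exact_mod_cast Nat.descFactorial_le_pow m d) hmd.le
    have hDmem : D ∈ summableOrbits N (1 - bernsteinOp m) := by
      refine summable_seminorm_iterate_of_eq_smul_add N _ (μ := 1 - lam) (v := D)
        (w := lam • (D - (m : ℝ) ^ d • X ^ d)) (by linarith) (by linarith) ?_ ?_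
      · have : lam * (m : ℝ) ^ d = m.descFactorial d := div_mul_cancel₀ _ hmd.ne'
        rw [LinearMap.sub_apply, Module.End.one_apply, bernsteinOp_scaledDescPochhammer hm hdm,
          smul_sub, smul_smul, this]
        module
      · refine Submodule.smul_mem _ _ (ih (mem_degreeLT_of_coeff_eq_zero ?_ fun n hn => ?_))
        · simp [hD, coeff_scaledDescPochhammer_self]
        · simp [hD, coeff_scaledDescPochhammer_of_lt hn, coeff_X_pow, hn.ne']
    intro p hp
    rw [mem_degreeLT, degree_lt_iff_coeff_zero] at hp
    rw [← sub_add_cancel p ((p.coeff d / (m : ℝ) ^ d) • D)]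
    refine add_mem (ih (mem_degreeLT_of_coeff_eq_zero ?_ fun n hn => ?_))
      (Submodule.smul_mem _ _ hDmem)
    · simp [hD, coeff_scaledDescPochhammer_self, hmd.ne']
    · simp [hD, coeff_scaledDescPochhammer_of_lt hn, hp n hn]

/-- The sup norm on `[0, 1]` as a seminorm on polynomials. -/
noncomputable def unitIntervalSeminorm : Seminorm ℝ ℝ[X] :=
  (normSeminorm ℝ C(Set.Icc (0 : ℝ) 1, ℝ)).comp
    (toContinuousMapOnAlgHom (Set.Icc (0 : ℝ) 1)).toLinearMap

lemma unitIntervalSeminorm_apply (p : ℝ[X]) :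
    unitIntervalSeminorm p = _root_.supNorm fun x => p.eval x := by
  change ‖p.toContinuousMapOn (Set.Icc (0 : ℝ) 1)‖ = _
  rw [ContinuousMap.norm_eq_iSup_norm]
  rfl

end Polynomial

/-- `I - B_m` applied repeatedly only sees, up to the fixed error `f - P`, a polynomial `P`
agreeing with `f` at the nodes. -/
lemma iterate_sub_Bop_of_eval_eq {m : ℕ} {f : ℝ → ℝ} {P : Polynomial ℝ}
    (hinterp : ∀ j ≤ m, P.eval ((j : ℝ) / (m : ℝ)) = f ((j : ℝ) / (m : ℝ))) (l : ℕ) (x : ℝ) :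
    ((fun g => g - Bop m g)^[l] f) x =
      f x - P.eval x + (((1 - Polynomial.bernsteinOp m) ^ l) P).eval x := by
  induction l generalizing x with
  | zero => simp
  | succ l ih =>
    have hB : Bop m ((fun g => g - Bop m g)^[l] f) x =
        Bop m (fun y => (((1 - Polynomial.bernsteinOp m) ^ l) P).eval y) x := by
      refine Finset.sum_congr rfl fun k hk => ?_
      rw [ih, hinterp k (Nat.lt_succ_iff.mp (Finset.mem_range.mp hk)), sub_self, zero_add]
    rw [Function.iterate_succ_apply', Pi.sub_apply, hB, ih, pow_succ', Module.End.mul_apply,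
      LinearMap.sub_apply, Module.End.one_apply, Polynomial.eval_sub, Polynomial.eval_bernsteinOp]
    ring

/-- as `ℓ → ∞`, `B_{m,ℓ}(f)` converges uniformly on `[0,1]` to the
Lagrange interpolant of `f` at the equispaced nodes. -/
theorem genBernstein_tendsto_lagrange (m : ℕ) (hm : 1 ≤ m) (f : ℝ → ℝ)
    (hf : ContinuousOn f (Set.Icc 0 1)) (P : Polynomial ℝ) (hdeg : P.natDegree ≤ m)
    (hinterp : ∀ j ≤ m, P.eval ((j : ℝ) / (m : ℝ)) = f ((j : ℝ) / (m : ℝ))) :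
    Filter.Tendsto (fun l : ℕ => supNorm (fun x => GBop m l f x - P.eval x))
      Filter.atTop (nhds 0) := by
  have hP : P ∈ summableOrbits Polynomial.unitIntervalSeminorm (1 - Polynomial.bernsteinOp m) := by
    refine Polynomial.degreeLT_le_summableOrbits (by omega) _ le_rfl ?_
    rw [Polynomial.mem_degreeLT]
    exact P.degree_le_natDegree.trans_lt (by exact_mod_cast Nat.lt_succ_of_le hdeg)
  refine (Summable.tendsto_atTop_zero hP).congr fun l => ?_
  rw [Polynomial.unitIntervalSeminorm_apply]
  refine iSup_congr fun x => ?_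
  rw [← abs_neg]
  simp only [GBop]
  rw [iterate_sub_Bop_of_eval_eq hinterp]
  congr 1
  ring
end
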